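/- There exist constants C₁, R₁ > 0 such that for all R ≥ R₁, ((p−1)/(2p)) Σ_{i=1}^ℓ ‖w_{i,R}‖²_V = 𝒥^{φ_n}(w_R) ≤ ℓ·n·𝔠_∞ − C₁ e^{−λ√(V_∞) R}, where w_R = (w_{1,R},…,w_{ℓ,R}) is the test ℓ-tuple built from translated truncations of ω. Consequently the infimum ĉ^{φ_n} over weak (n,ℓ)-pinwheel partitions satisfies ĉ^{φ_n} < ℓ·n·𝔠_∞. -/

import Mathlib

open MeasureTheory Filter Topology Real
open scoped RealInnerProductSpace ENNReal NNReal

noncomputable section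

/-- Euclidean space `ℝ^N`, identified with `ℂ × ℝ^{N-2}` via the first two coordinates. -/
abbrev E (N : ℕ) := EuclideanSpace ℝ (Fin N)

/-- The linear isometry of `ℝ^N ≡ ℂ × ℝ^{N-2}` given by `(z,y) ↦ (e^{iα} z, θ y)`:
rotation by the angle `α` in the first two coordinates together with a linear isometry
`θ ∈ O(N-2)` acting on the remaining coordinates. -/
def act (N : ℕ) (hN : 2 ≤ N) (α : ℝ)
    (θ : EuclideanSpace ℝ (Fin (N - 2)) ≃ₗᵢ[ℝ] EuclideanSpace ℝ (Fin (N - 2)))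
    (x : E N) : E N :=
  WithLp.toLp 2 fun i =>
    if h0 : (i : ℕ) = 0 then
      Real.cos α * x ⟨0, by omega⟩ - Real.sin α * x ⟨1, by omega⟩
    else if h1 : (i : ℕ) = 1 then
      Real.sin α * x ⟨0, by omega⟩ + Real.cos α * x ⟨1, by omega⟩
    else
      θ (WithLp.toLp 2 fun j : Fin (N - 2) => x ⟨(j : ℕ) + 2, by have := j.isLt; omega⟩)
        ⟨(i : ℕ) - 2, by have := i.isLt; omega⟩

/-- The identity element of `O(N-2)`. -/
def idO (N : ℕ) : EuclideanSpace ℝ (Fin (N - 2)) ≃ₗᵢ[ℝ] EuclideanSpace ℝ (Fin (N - 2)) :=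
  LinearIsometryEquiv.refl ℝ _

/-- The embedding `ℂ → ℂ × ℝ^{N-2} ≡ ℝ^N`, `w ↦ (w, 0)`. -/
def embedC (N : ℕ) (hN : 2 ≤ N) (w : ℂ) : E N :=
  WithLp.toLp 2 fun i => if (i : ℕ) = 0 then w.re else if (i : ℕ) = 1 then w.im else 0

/-- Membership in the Sobolev space `H¹(ℝ^N)`. -/
def MemH1 (N : ℕ) (u : E N → ℝ) : Prop :=
  Differentiable ℝ u ∧ MemLp u 2 volume ∧ MemLp (fun x => gradient u x) 2 volume

/-- The squared norm `‖u‖_V² = ∫ (|∇u|² + V(x) u²)`. -/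
def normVSq (N : ℕ) (V : E N → ℝ) (u : E N → ℝ) : ℝ :=
  ∫ x, (‖gradient u x‖ ^ 2 + V x * u x ^ 2)

/-- The squared `H¹`-distance between `u` and `v`. -/
def H1distSq (N : ℕ) (u v : E N → ℝ) : ℝ :=
  ∫ x, (‖gradient u x - gradient v x‖ ^ 2 + (u x - v x) ^ 2)

/-- Strong convergence in `H¹(ℝ^N)`. -/
def TendstoH1 (N : ℕ) (u : ℕ → E N → ℝ) (v : E N → ℝ) : Prop :=
  Filter.Tendsto (fun k => H1distSq N (u k) v) Filter.atTop (nhds 0)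

/-- Test functions: smooth with compact support. -/
def IsTest (N : ℕ) (v : E N → ℝ) : Prop := ContDiff ℝ (⊤ : ℕ∞) v ∧ HasCompactSupport v

/-- `u` is a (weak) solution of the competitive system
`-Δuᵢ + V uᵢ = |uᵢ|^{2p-2}uᵢ + β ∑_{j≠i} |u_j|^p |uᵢ|^{p-2} uᵢ`. -/
def IsSolution (N ℓ : ℕ) (V : E N → ℝ) (β p : ℝ) (u : Fin ℓ → E N → ℝ) : Prop :=
  (∀ i, MemH1 N (u i)) ∧
  ∀ (i : Fin ℓ) (v : E N → ℝ), IsTest N v →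
    ∫ x, (⟪gradient (u i) x, gradient v x⟫ + V x * u i x * v x) =
      ∫ x, (|u i x| ^ (2 * p - 2) * u i x * v x
        + β * (∑ j ∈ Finset.univ.erase i, |u j x| ^ p) * |u i x| ^ (p - 2) * u i x * v x)

/-- `u` is a (weak) solution of the single equation `-Δu + V u = c |u|^{2p-2} u`. -/
def IsEqSolution (N : ℕ) (V : E N → ℝ) (c p : ℝ) (u : E N → ℝ) : Prop :=
  MemH1 N u ∧
  ∀ v : E N → ℝ, IsTest N v →
    ∫ x, (⟪gradient u x, gradient v x⟫ + V x * u x * v x) =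
      c * ∫ x, |u x| ^ (2 * p - 2) * u x * v x

/-- The pinwheel symmetries: `u₁(e^{2πi/n} z, θ y) = u₁(z,y)` for every `θ ∈ O(N-2)`,
and `u_{j+1}(z,y) = u₁(e^{2πij/(ℓn)} z, y)`. -/
def Pinwheel (N : ℕ) (hN : 2 ≤ N) (n ℓ : ℕ) (hℓ : 0 < ℓ) (u : Fin ℓ → E N → ℝ) : Prop :=
  (∀ θ x, u ⟨0, hℓ⟩ (act N hN (2 * π / (n : ℝ)) θ x) = u ⟨0, hℓ⟩ x) ∧
  (∀ (j : Fin ℓ) (x : E N),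
    u j x = u ⟨0, hℓ⟩ (act N hN (2 * π * ((j : ℕ) : ℝ) / ((ℓ : ℝ) * (n : ℝ))) (idO N) x))

/-- `G_n`-invariance: `u(e^{2πi/n} z, θ y) = u(z,y)` for every `θ ∈ O(N-2)`. -/
def GInv (N : ℕ) (hN : 2 ≤ N) (n : ℕ) (u : E N → ℝ) : Prop :=
  ∀ θ x, u (act N hN (2 * π / (n : ℝ)) θ x) = u x

/-- `τ_n`-equivariance: `u(e^{πi/n} z, y) = -u(z,y)` and `u(z, θ y) = u(z,y)`. -/
def TauInv (N : ℕ) (hN : 2 ≤ N) (n : ℕ) (u : E N → ℝ) : Prop :=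
  (∀ x, u (act N hN (π / (n : ℝ)) (idO N) x) = -u x) ∧
  (∀ θ x, u (act N hN 0 θ x) = u x)

/-- A radial function. -/
def Radial (N : ℕ) (u : E N → ℝ) : Prop := ∀ x y : E N, ‖x‖ = ‖y‖ → u x = u y

/-- Hypothesis `(V₂)`: `0 < inf V` and `V(x) → V_∞ > 0` as `|x| → ∞`. -/
def HypV2 (N : ℕ) (V : E N → ℝ) (Vinf : ℝ) : Prop :=
  (∃ c > 0, ∀ x, c ≤ V x) ∧ 0 < Vinf ∧
    Filter.Tendsto V (Filter.cocompact (E N)) (nhds Vinf)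

/-- Hypothesis `(V₃ⁿ)`. -/
def HypV3 (N ℓ n : ℕ) (V : E N → ℝ) (Vinf : ℝ) : Prop :=
  ∃ C₀ > 0, ∃ R₀ > 0, ∃ lam : ℝ,
    0 < lam ∧ lam < 2 * Real.sin (π / ((ℓ : ℝ) * (n : ℝ))) ∧
    ∀ x : E N, R₀ ≤ ‖x‖ → V x ≤ Vinf - C₀ * Real.exp (-lam * Real.sqrt Vinf * ‖x‖)

/-- The energy functional `𝒥` of the system. -/
def energy (N ℓ : ℕ) (V : E N → ℝ) (β p : ℝ) (u : Fin ℓ → E N → ℝ) : ℝ :=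
  (1 / 2) * ∑ i, normVSq N V (u i)
    - (1 / (2 * p)) * ∑ i, ∫ x, |u i x| ^ (2 * p)
    - (β / (2 * p)) * ∑ i, ∑ j ∈ Finset.univ.erase i, ∫ x, |u i x| ^ p * |u j x| ^ p

/-- The energy functional `J` of a single equation. -/
def Jfun (N : ℕ) (V : E N → ℝ) (p : ℝ) (u : E N → ℝ) : ℝ :=
  (1 / 2) * normVSq N V u - (1 / (2 * p)) * ∫ x, |u x| ^ (2 * p)

/-- The derivative of `𝒥` at `u` in the direction `v`. -/
def dJ (N ℓ : ℕ) (V : E N → ℝ) (β p : ℝ) (u v : Fin ℓ → E N → ℝ) : ℝ :=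
  ∑ i, ((∫ x, (⟪gradient (u i) x, gradient (v i) x⟫ + V x * u i x * v i x))
    - (∫ x, |u i x| ^ (2 * p - 2) * u i x * v i x)
    - β * ∑ j ∈ Finset.univ.erase i, ∫ x, |u j x| ^ p * |u i x| ^ (p - 2) * u i x * v i x)

/-- The derivative of `Ψ(u) = 𝒥'(u)u` at `u` in the direction `v`. -/
def dPsi (N ℓ : ℕ) (V : E N → ℝ) (β p : ℝ) (u v : Fin ℓ → E N → ℝ) : ℝ :=
  ∑ i, (2 * (∫ x, (⟪gradient (u i) x, gradient (v i) x⟫ + V x * u i x * v i x))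
    - 2 * p * (∫ x, |u i x| ^ (2 * p - 2) * u i x * v i x)
    - 2 * p * β *
        ∑ j ∈ Finset.univ.erase i, ∫ x, |u j x| ^ p * |u i x| ^ (p - 2) * u i x * v i x)

/-- The Nehari set `𝒩^{φ_n}`. -/
def InNehari (N : ℕ) (hN : 2 ≤ N) (ℓ n : ℕ) (hℓ : 0 < ℓ) (V : E N → ℝ) (β p : ℝ)
    (u : Fin ℓ → E N → ℝ) : Prop :=
  (∀ i, MemH1 N (u i)) ∧ Pinwheel N hN n ℓ hℓ u ∧
  ∀ i, u i ≠ 0 ∧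
    normVSq N V (u i) =
      (∫ x, |u i x| ^ (2 * p)) +
        β * ∑ j ∈ Finset.univ.erase i, ∫ x, |u i x| ^ p * |u j x| ^ p

/-- `c^{φ_n} := inf_{𝒩^{φ_n}} 𝒥`. -/
def cPhi (N : ℕ) (hN : 2 ≤ N) (ℓ n : ℕ) (hℓ : 0 < ℓ) (V : E N → ℝ) (β p : ℝ) : ℝ :=
  sInf (energy N ℓ V β p '' {u | InNehari N hN ℓ n hℓ V β p u})

/-- The ground state energy `𝔠_∞` of the limit problem `-Δu + V_∞ u = |u|^{2p-2}u`. -/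
def cInfty (N : ℕ) (p Vinf : ℝ) : ℝ :=
  sInf (Jfun N (fun _ => Vinf) p ''
    {u | MemH1 N u ∧ u ≠ 0 ∧ normVSq N (fun _ => Vinf) u = ∫ x, |u x| ^ (2 * p)})

/-- The least energy `𝔠^{G_n}` on the `G_n`-invariant Nehari manifold. -/
def cGn (N : ℕ) (hN : 2 ≤ N) (n : ℕ) (V : E N → ℝ) (p : ℝ) : ℝ :=
  sInf (Jfun N V p ''
    {u | MemH1 N u ∧ u ≠ 0 ∧ GInv N hN n u ∧ normVSq N V u = ∫ x, |u x| ^ (2 * p)})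

/-- A least energy fully nontrivial (positive) solution of the system satisfying the
pinwheel symmetries. -/
def IsLeastEnergySol (N : ℕ) (hN : 2 ≤ N) (ℓ n : ℕ) (hℓ : 0 < ℓ) (V : E N → ℝ) (β p : ℝ)
    (u : Fin ℓ → E N → ℝ) : Prop :=
  IsSolution N ℓ V β p u ∧ (∀ i x, 0 < u i x) ∧ Pinwheel N hN n ℓ hℓ u ∧
  ∀ w, IsSolution N ℓ V β p w → (∀ i x, 0 < w i x) → Pinwheel N hN n ℓ hℓ w →
    energy N ℓ V β p u ≤ energy N ℓ V β p w

/-- The set `𝒲^n_ℓ` of weak `(n,ℓ)`-pinwheel partitions. -/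
def WeakPartition (N : ℕ) (hN : 2 ≤ N) (ℓ n : ℕ) (hℓ : 0 < ℓ) (V : E N → ℝ) (p : ℝ) :
    Set (Fin ℓ → E N → ℝ) :=
  {u | (∀ i, MemH1 N (u i)) ∧ Pinwheel N hN n ℓ hℓ u ∧
    (∀ i, u i ≠ 0 ∧ normVSq N V (u i) = ∫ x, |u i x| ^ (2 * p)) ∧
    ∀ i j, i ≠ j → ∀ x, u i x * u j x = 0}

/-- `ĉ^{φ_n} := inf_{𝒲^n_ℓ} (p-1)/(2p) ∑ ‖uᵢ‖_V²`. -/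
def hatC (N : ℕ) (hN : 2 ≤ N) (ℓ n : ℕ) (hℓ : 0 < ℓ) (V : E N → ℝ) (p : ℝ) : ℝ :=
  sInf ((fun u : Fin ℓ → E N → ℝ => (p - 1) / (2 * p) * ∑ i, normVSq N V (u i)) ''
    WeakPartition N hN ℓ n hℓ V p)

/-- The `G_n`-invariant Nehari set `𝓜_Ω` in `H¹₀(Ω)`. -/
def MOmega (N : ℕ) (hN : 2 ≤ N) (n : ℕ) (V : E N → ℝ) (p : ℝ) (Ω : Set (E N)) :
    Set (E N → ℝ) :=
  {u | MemH1 N u ∧ u ≠ 0 ∧ (∀ x ∉ Ω, u x = 0) ∧ GInv N hN n u ∧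
    normVSq N V u = ∫ x, |u x| ^ (2 * p)}

/-- `𝔠_Ω := inf_{𝓜_Ω} (p-1)/(2p) ‖u‖_V²`. -/
def cOmega (N : ℕ) (hN : 2 ≤ N) (n : ℕ) (V : E N → ℝ) (p : ℝ) (Ω : Set (E N)) : ℝ :=
  sInf ((fun u => (p - 1) / (2 * p) * normVSq N V u) '' MOmega N hN n V p Ω)

/-- An `(n,ℓ)`-pinwheel partition of `ℝ^N`. -/
def IsPinwheelPartition (N : ℕ) (hN : 2 ≤ N) (ℓ n : ℕ) (hℓ : 0 < ℓ)
    (Ω : Fin ℓ → Set (E N)) : Prop :=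
  (∀ j, (Ω j).Nonempty ∧ IsOpen (Ω j)) ∧
  (∀ i j, i ≠ j → Ω i ∩ Ω j = ∅) ∧
  (∀ j : Fin ℓ, Ω j =
    {x | act N hN (2 * π * ((j : ℕ) : ℝ) / ((ℓ : ℝ) * (n : ℝ))) (idO N) x ∈ Ω ⟨0, hℓ⟩}) ∧
  (∀ θ, ∀ x ∈ Ω ⟨0, hℓ⟩, act N hN (2 * π / (n : ℝ)) θ x ∈ Ω ⟨0, hℓ⟩)

/-- An optimal `(n,ℓ)`-pinwheel partition for the equation `-Δu + Vu = |u|^{2p-2}u`. -/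
def IsOptimalPinwheelPartition (N : ℕ) (hN : 2 ≤ N) (ℓ n : ℕ) (hℓ : 0 < ℓ)
    (V : E N → ℝ) (p : ℝ) (Ω : Fin ℓ → Set (E N)) : Prop :=
  IsPinwheelPartition N hN ℓ n hℓ Ω ∧
  (∀ j, ∃ u ∈ MOmega N hN n V p (Ω j),
    (p - 1) / (2 * p) * normVSq N V u = cOmega N hN n V p (Ω j)) ∧
  (∑ j, cOmega N hN n V p (Ω j)) =
    sInf {s | ∃ Θ : Fin ℓ → Set (E N), IsPinwheelPartition N hN ℓ n hℓ Θ ∧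
      s = ∑ j, cOmega N hN n V p (Θ j)}

/-- The Nehari manifold `𝓜^{τ_n}` of `τ_n`-equivariant functions. -/
def MTau (N : ℕ) (hN : 2 ≤ N) (n : ℕ) (V : E N → ℝ) (p : ℝ) : Set (E N → ℝ) :=
  {u | MemH1 N u ∧ u ≠ 0 ∧ TauInv N hN n u ∧ normVSq N V u = ∫ x, |u x| ^ (2 * p)}

/-- The sum of `n` truncated copies of `ω` placed at the vertices `R e^{2πij/n}` of a
regular `n`-gon in `ℂ × {0}`; the truncation radius is `ϱ R`. -/
def bumpSum (N : ℕ) (hN : 2 ≤ N) (n : ℕ) (ω χ : E N → ℝ) (ϱ R : ℝ) (x : E N) : ℝ :=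
  ∑ j ∈ Finset.range n,
    χ ((ϱ * R)⁻¹ •
        (x - R • embedC N hN (Complex.exp (((2 * π * (j : ℝ) / (n : ℝ) : ℝ) : ℂ) * Complex.I)))) *
      ω (x - R • embedC N hN (Complex.exp (((2 * π * (j : ℝ) / (n : ℝ) : ℝ) : ℂ) * Complex.I)))

/-- The test `ℓ`-tuple `w_R` built from translated truncations of `ω`, scaled by `t`. -/
def testTuple (N : ℕ) (hN : 2 ≤ N) (ℓ n : ℕ) (ω χ : E N → ℝ) (ϱ R t : ℝ) :
    Fin ℓ → E N → ℝ :=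
  fun i x => t * bumpSum N hN n ω χ ϱ R
    (act N hN (2 * π * ((i : ℕ) : ℝ) / ((ℓ : ℝ) * (n : ℝ))) (idO N) x)

end



theorem ode_decay (k : ℕ) (f P : ℝ → ℝ) (c p μ : ℝ) (hp : 1 < p)
    (hpos : ∀ r, 0 < r → 0 < f r) (hf : ∀ r, 0 < r → HasDerivAt f (P r) r)
    (hP : ∀ r, 0 < r → HasDerivAt (fun r => r ^ k * P r)
      (r ^ k * (c * f r - f r ^ (2 * p - 2) * f r)) r)
    (hlim : Tendsto f atTop (𝓝 0)) (hμ : 0 < μ) (hμc : μ ^ 2 < c) :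
    ∃ K > 0, ∃ r0 > 0, ∀ r ≥ r0, f r ≤ K * exp (-μ * r) ∧ |P r| ≤ K * exp (-μ * r) := by
  have h1 : Tendsto (fun r => f r ^ (2 * p - 2)) atTop (𝓝 0) := by
    have := hlim.rpow_const (p := 2 * p - 2) (Or.inr (by linarith))
    rwa [Real.zero_rpow (by linarith)] at this
  obtain ⟨r1, hr1⟩ := eventually_atTop.1 (h1.eventually (gt_mem_nhds (sub_pos.2 hμc)))
  obtain ⟨r0, hr0, hr01⟩ : ∃ r0 : ℝ, 0 < r0 ∧ r1 ≤ r0 :=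
    ⟨max r1 1, by positivity, le_max_left _ _⟩
  have hq : ∀ r ≥ r0, μ ^ 2 * f r ≤ c * f r - f r ^ (2 * p - 2) * f r := by
    intro r hr
    have a := hr1 r (by linarith)
    have b := hpos r (by linarith)
    nlinarith
  have hgm : MonotoneOn (fun r => r ^ k * P r) (Set.Ici r0) := by
    apply monotoneOn_of_hasDerivWithinAt_nonneg (convex_Ici _) (f' := fun r =>
      (r ^ k * (c * f r - f r ^ (2 * p - 2) * f r)))
    · intro x hx
      exact (hP x (by simp at hx; linarith)).continuousAt.continuousWithinAt
    · intro x hx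
      simp at hx
      exact (hP x (by linarith)).hasDerivWithinAt
    · intro x hx
      simp at hx
      have := hq x (by linarith)
      have b := hpos x (by linarith)
      have : 0 ≤ c * f x - f x ^ (2 * p - 2) * f x := le_trans (by positivity) this
      have : 0 < x := by linarith
      positivity
  have hP0 : ∀ r ≥ r0, P r ≤ 0 := by
    intro r2 hr2
    by_contra! hcon
    have hr20 : 0 < r2 := by linarith
    have h3 : ∀ r ≥ r2, 0 < P r := by
      intro r hr
      have := hgm (Set.mem_Ici.2 hr2) (Set.mem_Ici.2 (le_trans hr2 hr)) hr
      simp only at this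
      have h5 : 0 < r2 ^ k * P r2 := by positivity
      have h6 : 0 < r ^ k := by have : 0 < r := by linarith
                                positivity
      exact pos_of_mul_pos_right (lt_of_lt_of_le h5 this) h6.le
    have h4 : MonotoneOn f (Set.Ici r2) := by
      apply monotoneOn_of_hasDerivWithinAt_nonneg (convex_Ici _) (f' := P)
      · intro x hx
        exact (hf x (by simp at hx; linarith)).continuousAt.continuousWithinAt
      · intro x hx
        simp at hx
        exact (hf x (by linarith)).hasDerivWithinAt
      · intro x hx
        simp at hx
        exact (h3 x hx.le).le
    have h5 : f r2 ≤ 0 := by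
      apply ge_of_tendsto hlim
      filter_upwards [eventually_ge_atTop r2] with r hr
      exact h4 (Set.mem_Ici.2 le_rfl) (Set.mem_Ici.2 hr) hr
    linarith [hpos r2 hr20]
  -- derivative of P
  have hPd : ∀ r, 0 < r → HasDerivAt P ((c * f r - f r ^ (2 * p - 2) * f r) - k / r * P r) r := by
    intro r hr
    have h2 : HasDerivAt (fun r : ℝ => (r ^ k)⁻¹) (-(k * r ^ (k - 1)) / (r ^ k) ^ 2) r :=
      (hasDerivAt_pow k r).fun_inv (by positivity)
    have h3 := (hP r hr).mul h2
    have h4 : HasDerivAt P (r ^ k * (c * f r - f r ^ (2 * p - 2) * f r) * (r ^ k)⁻¹ +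
        r ^ k * P r * (-(↑k * r ^ (k - 1)) / (r ^ k) ^ 2)) r := by
      refine h3.congr_of_eventuallyEq ?_
      filter_upwards [lt_mem_nhds hr] with s hs
      simp only [Pi.mul_apply]
      field_simp
    convert h4 using 1
    rcases k with _ | k
    · simp
    · simp only [Nat.add_sub_cancel]
      field_simp
      ring
  have hPd2 : ∀ r ≥ r0, μ ^ 2 * f r ≤ (c * f r - f r ^ (2 * p - 2) * f r) - k / r * P r := by
    intro r hr
    have a := hq r hr
    have b := hP0 r hr
    have : 0 ≤ (k : ℝ) / r := by
      have : 0 < r := by linarith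
      positivity
    nlinarith
  have hPm : MonotoneOn P (Set.Ici r0) := by
    apply monotoneOn_of_hasDerivWithinAt_nonneg (convex_Ici _) (f' := fun r =>
      ((c * f r - f r ^ (2 * p - 2) * f r) - k / r * P r))
    · intro x hx
      exact (hPd x (by simp at hx; linarith)).continuousAt.continuousWithinAt
    · intro x hx
      simp at hx
      exact (hPd x (by linarith)).hasDerivWithinAt
    · intro x hx
      simp at hx
      have := hPd2 x hx.le
      have b := hpos x (by linarith)
      exact le_trans (by positivity) this
  have hmm : MonotoneOn (fun r => (P r + μ * f r) * exp (-μ * r)) (Set.Ici r0) := by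
    have hd : ∀ r, 0 < r → HasDerivAt (fun r => (P r + μ * f r) * exp (-μ * r))
        ((((c * f r - f r ^ (2 * p - 2) * f r) - k / r * P r) - μ ^ 2 * f r) * exp (-μ * r)) r := by
      intro r hr
      have e1 : HasDerivAt (fun r => exp (-μ * r)) (exp (-μ * r) * (-μ * 1)) r :=
        ((hasDerivAt_id r).const_mul (-μ)).exp
      have := ((hPd r hr).add ((hf r hr).const_mul μ)).mul e1
      refine this.congr_deriv ?_
      simp only [Pi.add_apply]
      ring
    apply monotoneOn_of_hasDerivWithinAt_nonneg (convex_Ici _) (f' := fun r =>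
      ((((c * f r - f r ^ (2 * p - 2) * f r) - k / r * P r) - μ ^ 2 * f r) * exp (-μ * r)))
    · intro x hx
      exact (hd x (by simp at hx; linarith)).continuousAt.continuousWithinAt
    · intro x hx
      simp at hx
      exact (hd x (by linarith)).hasDerivWithinAt
    · intro x hx
      simp at hx
      have := hPd2 x hx.le
      exact mul_nonneg (by linarith) (exp_pos _).le
  have hh : ∀ r ≥ r0, P r + μ * f r ≤ 0 := by
    intro r2 hr2
    by_contra! hcon
    have hr20 : 0 < r2 := by linarith
    set m := (P r2 + μ * f r2) * exp (-μ * r2) with hm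
    have hm0 : 0 < m := by positivity
    have h5 : m ≤ μ * 0 := by
      apply ge_of_tendsto (hlim.const_mul μ)
      filter_upwards [eventually_ge_atTop r2] with r hr
      have a := hmm (Set.mem_Ici.2 hr2) (Set.mem_Ici.2 (le_trans hr2 hr)) hr
      simp only at a
      rw [← hm] at a
      have b := hP0 r (le_trans hr2 hr)
      have c1 : exp (-μ * r) ≤ 1 := by
        rw [Real.exp_le_one_iff]
        have : 0 < r := by linarith
        nlinarith
      have c2 := exp_pos (-μ * r)
      have c3 := hpos r (by linarith)
      have c4 : (P r + μ * f r) * exp (-μ * r) ≤ (μ * f r) * exp (-μ * r) := by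
        gcongr; linarith
      have c5 : (μ * f r) * exp (-μ * r) ≤ (μ * f r) * 1 := by
        gcongr
      linarith
    linarith
  have hfa : AntitoneOn (fun r => f r * exp (μ * r)) (Set.Ici r0) := by
    have hd : ∀ r, 0 < r → HasDerivAt (fun r => f r * exp (μ * r))
        ((P r + μ * f r) * exp (μ * r)) r := by
      intro r hr
      have e1 : HasDerivAt (fun r => exp (μ * r)) (exp (μ * r) * (μ * 1)) r :=
        ((hasDerivAt_id r).const_mul (μ)).exp
      have := (hf r hr).mul e1
      refine this.congr_deriv ?_
      ring
    apply antitoneOn_of_hasDerivWithinAt_nonpos (convex_Ici _) (f' := fun r =>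
      (P r + μ * f r) * exp (μ * r))
    · intro x hx
      exact (hd x (by simp at hx; linarith)).continuousAt.continuousWithinAt
    · intro x hx
      simp at hx
      exact (hd x (by linarith)).hasDerivWithinAt
    · intro x hx
      simp at hx
      have := hh x hx.le
      exact mul_nonpos_of_nonpos_of_nonneg (by linarith) (exp_pos _).le
  set K0 := f r0 * exp (μ * r0) with hK0
  have hK0p : 0 < K0 := mul_pos (hpos _ hr0) (exp_pos _)
  have hfb : ∀ r ≥ r0, f r ≤ K0 * exp (-μ * r) := by
    intro r hr
    have := hfa (Set.mem_Ici.2 le_rfl) (Set.mem_Ici.2 hr) hr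
    simp only at this
    rw [← hK0] at this
    have e : exp (μ * r) * exp (-μ * r) = 1 := by rw [← exp_add]; simp
    calc f r = f r * exp (μ * r) * exp (-μ * r) := by rw [mul_assoc, e, mul_one]
      _ ≤ _ := by gcongr
  refine ⟨K0 * exp μ, by positivity, r0 + 1, by linarith, fun r hr => ⟨?_, ?_⟩⟩
  · refine (hfb r (by linarith)).trans ?_
    have : 1 ≤ exp μ := Real.one_le_exp hμ.le
    have := exp_pos (-μ * r)
    gcongr
    nlinarith
  · rw [abs_of_nonpos (hP0 r (by linarith))]
    obtain ⟨ξ, hξ, hξ2⟩ := exists_hasDerivAt_eq_slope f P (show r - 1 < r by linarith)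
      (fun x hx => (hf x (by have := hx.1; linarith)).continuousAt.continuousWithinAt)
      (fun x hx => hf x (by have := hx.1; linarith))
    have h7 : P ξ ≤ P r := hPm (Set.mem_Ici.2 (by linarith [hξ.1])) (Set.mem_Ici.2 (by linarith)) hξ.2.le
    have h8 := hfb (r - 1) (by linarith)
    have h9 : exp (-μ * (r - 1)) = exp μ * exp (-μ * r) := by rw [← exp_add]; ring_nf
    rw [h9, ← mul_assoc] at h8
    have h10 := hpos r (by linarith)
    have : r - (r - 1) = 1 := by ring
    rw [this, div_one] at hξ2
    linarith



theorem int_loc {H g : ℝ → ℝ} (hH : LocallyIntegrableOn H (Set.Ioi 0)) (hg : Continuous g)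
    (hgc : HasCompactSupport g) (hgs : tsupport g ⊆ Set.Ioi 0) :
    Integrable (fun r => H r * g r) := by
  have h1 : IntegrableOn H (tsupport g) := hH.integrableOn_compact_subset hgs hgc
  have h2 : IntegrableOn (fun r => H r * g r) (tsupport g) := h1.mul_continuousOn hg.continuousOn hgc
  rwa [integrableOn_iff_integrable_of_support_subset] at h2
  intro x hx
  apply subset_tsupport
  simp only [Function.mem_support] at hx ⊢
  exact right_ne_zero_of_mul hx

theorem dbr_const (H : ℝ → ℝ) (hH : LocallyIntegrableOn H (Set.Ioi 0))
    (hw : ∀ ψ : ℝ → ℝ, ContDiff ℝ (⊤ : ℕ∞) ψ → HasCompactSupport ψ → tsupport ψ ⊆ Set.Ioi 0 →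
      ∫ r, H r * deriv ψ r = 0) :
    ∃ c : ℝ, ∀ᵐ r, r ∈ Set.Ioi (0 : ℝ) → H r - c = 0 := by
  let B : ContDiffBump (2 : ℝ) := ⟨1 / 2, 1, by norm_num, by norm_num⟩
  let b : ℝ → ℝ := B.normed volume
  have hb1 : ∫ r, b r = 1 := B.integral_normed
  have hbd : ContDiff ℝ (⊤ : ℕ∞) b := B.contDiff_normed
  have hbc : HasCompactSupport b := B.hasCompactSupport_normed
  have hbs : tsupport b ⊆ Set.Ioi 0 := by
    rw [show tsupport b = _ from B.tsupport_normed_eq]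
    intro x hx
    simp only [Metric.mem_closedBall, Real.dist_eq, B] at hx
    have := abs_le.1 hx
    simp only [Set.mem_Ioi]; linarith
  refine ⟨∫ r, H r * b r, ?_⟩
  apply isOpen_Ioi.ae_eq_zero_of_integral_contDiff_smul_eq_zero
  · exact hH.sub ((continuous_const).locallyIntegrable.locallyIntegrableOn _)
  intro φ hφ hφc hφs
  set m := ∫ r, φ r with hm
  set η : ℝ → ℝ := fun r => φ r - m * b r with hη
  have hηd : ContDiff ℝ (⊤ : ℕ∞) η := hφ.sub (contDiff_const.mul hbd)
  set Kc := tsupport φ ∪ tsupport b with hKc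
  have hKcc : IsCompact Kc := hφc.isCompact.union hbc.isCompact
  have hKs : Kc ⊆ Set.Ioi 0 := Set.union_subset hφs hbs
  have hη0 : ∀ r ∉ Kc, η r = 0 := by
    intro r hr
    simp only [hKc, Set.mem_union, not_or] at hr
    simp [hη, image_eq_zero_of_notMem_tsupport hr.1, image_eq_zero_of_notMem_tsupport hr.2]
  have hηi : Integrable η := (hφ.continuous.integrable_of_hasCompactSupport hφc).sub
    ((hbd.continuous.integrable_of_hasCompactSupport hbc).const_mul m)
  have hηint : ∫ r, η r = 0 := by
    rw [hη, integral_sub (hφ.continuous.integrable_of_hasCompactSupport hφc)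
    ((hbd.continuous.integrable_of_hasCompactSupport hbc).const_mul m), integral_const_mul, hb1]
    simp [hm]
  -- bounds
  have hKne : Kc.Nonempty := by
    have : b ≠ 0 := by
      intro h; simp [h] at hb1
    obtain ⟨x, hx⟩ := Function.support_nonempty_iff.2 this
    exact ⟨x, Or.inr (subset_tsupport _ hx)⟩
  obtain ⟨a, haK, ha⟩ := hKcc.exists_isLeast hKne
  obtain ⟨d, hdK, hd⟩ := hKcc.exists_isGreatest hKne
  have ha0 : 0 < a := hKs haK
  set ψ : ℝ → ℝ := fun r => ∫ s in (a)..r, η s with hψ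
  have hψd : ∀ r, HasDerivAt ψ (η r) r := fun r =>
    intervalIntegral.integral_hasDerivAt_right (hηi.intervalIntegrable)
      (hηd.continuous.stronglyMeasurableAtFilter _ _) hηd.continuous.continuousAt
  have hψderiv : deriv ψ = η := funext fun r => (hψd r).deriv
  have hψs : ContDiff ℝ (⊤ : ℕ∞) ψ := by
    rw [contDiff_infty_iff_deriv]
    refine ⟨fun r => (hψd r).differentiableAt, ?_⟩
    rw [hψderiv]; exact hηd
  have hψ0 : ∀ r ∉ Set.Icc a d, ψ r = 0 := by
    intro r hr
    simp only [Set.mem_Icc, not_and_or, not_le] at hr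
    rcases hr with hr | hr
    · simp only [hψ]
      rw [intervalIntegral.integral_symm, neg_eq_zero]
      apply intervalIntegral.integral_zero_ae
      have : ∀ᵐ x : ℝ, x ≠ a := by simp [ae_iff]
      filter_upwards [this] with x hxa hx
      rw [Set.uIoc_of_le hr.le] at hx
      apply hη0
      intro h
      exact hxa (le_antisymm hx.2 (ha h))
    · simp only [hψ]
      have had : a ≤ d := ha hdK
      rw [intervalIntegral.integral_of_le (by linarith), ← integral_Icc_eq_integral_Ioc,
        setIntegral_eq_integral_of_forall_compl_eq_zero, hηint]
      intro x hx
      apply hη0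
      intro h
      exact hx ⟨ha h, (hd h).trans hr.le⟩
  have hψts : tsupport ψ ⊆ Set.Icc a d := by
    apply closure_minimal _ isClosed_Icc
    intro x hx
    by_contra h
    exact hx (hψ0 x h)
  have hψc : HasCompactSupport ψ := isCompact_Icc.of_isClosed_subset (isClosed_tsupport _) hψts
  have key := hw ψ hψs hψc (hψts.trans fun x hx => lt_of_lt_of_le ha0 hx.1)
  rw [hψderiv] at key
  have i1 := int_loc hH hφ.continuous hφc hφs
  have i2 := int_loc hH hbd.continuous hbc hbs
  have e1 : ∫ r, H r * η r = (∫ r, H r * φ r) - m * ∫ r, H r * b r := by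
    rw [← integral_const_mul, ← integral_sub i1 (i2.const_mul m)]
    congr 1; ext r; simp only [hη]; ring
  have e2 : ∫ r, φ r • (H r - ∫ r, H r * b r) = (∫ r, H r * φ r) - (∫ r, H r * b r) * m := by
    rw [hm, ← integral_const_mul, ← integral_sub i1
      ((hφ.continuous.integrable_of_hasCompactSupport hφc).const_mul _)]
    congr 1; ext r; simp only [smul_eq_mul]; ring
  rw [e2]; rw [e1] at key; linarith

theorem dbr (H q : ℝ → ℝ) (hH : LocallyIntegrableOn H (Set.Ioi 0))
    (hq : ContinuousOn q (Set.Ioi 0))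
    (hw : ∀ ψ : ℝ → ℝ, ContDiff ℝ (⊤ : ℕ∞) ψ → HasCompactSupport ψ → tsupport ψ ⊆ Set.Ioi 0 →
      ∫ r in Set.Ioi 0, (H r * deriv ψ r + q r * ψ r) = 0) :
    ∃ Q : ℝ → ℝ, (∀ r, 0 < r → HasDerivAt Q (q r) r) ∧ ∀ᵐ r, r ∈ Set.Ioi (0 : ℝ) → H r = Q r := by
  set Q : ℝ → ℝ := fun r => ∫ s in (1 : ℝ)..r, q s with hQ
  have hQd : ∀ r, 0 < r → HasDerivAt Q (q r) r := by
    intro r hr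
    apply intervalIntegral.integral_hasDerivAt_right
    · apply ContinuousOn.intervalIntegrable
      apply hq.mono
      intro x hx
      rw [Set.mem_uIcc] at hx
      simp only [Set.mem_Ioi]
      rcases hx with h | h <;> linarith [h.1]
    · exact hq.stronglyMeasurableAtFilter isOpen_Ioi _ hr
    · exact hq.continuousAt (isOpen_Ioi.mem_nhds hr)
  have hQc : ContinuousOn Q (Set.Ioi 0) := fun r hr => (hQd r hr).continuousAt.continuousWithinAt
  have hQl : LocallyIntegrableOn Q (Set.Ioi 0) := hQc.locallyIntegrableOn measurableSet_Ioi
  have hql : LocallyIntegrableOn q (Set.Ioi 0) := hq.locallyIntegrableOn measurableSet_Ioi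
  obtain ⟨c, hc⟩ := dbr_const (fun r => H r - Q r) (hH.sub hQl) (by
    intro ψ hψ hψc hψs
    have hdc : Continuous (deriv ψ) := (contDiff_infty_iff_deriv.1 hψ).2.continuous
    have hds : tsupport (deriv ψ) ⊆ tsupport ψ := closure_minimal (support_deriv_subset) (isClosed_tsupport _)
    have hdcs : HasCompactSupport (deriv ψ) := hψc.deriv
    have i1 := int_loc hH hdc hdcs (hds.trans hψs)
    have i2 := int_loc hQl hdc hdcs (hds.trans hψs)
    have i3 := int_loc hql hψ.continuous hψc hψs
    have i4 := int_loc hQl hψ.continuous hψc hψs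
    have e0 : ∫ r, (q r * ψ r + Q r * deriv ψ r) = 0 := by
      apply integral_eq_zero_of_hasDerivAt_of_integrable (f := fun r => Q r * ψ r) _ (i3.add i2) i4
      intro x
      by_cases hx : 0 < x
      · exact (hQd x hx).mul ((hψ.differentiable (by simp)) x).hasDerivAt
      · have hx' : x ∉ tsupport ψ := fun h => hx (hψs h)
        have hz : ψ =ᶠ[𝓝 x] 0 := notMem_tsupport_iff_eventuallyEq.1 hx'
        have hd0 : deriv ψ x = 0 := by rw [hz.deriv_eq]; simp
        change HasDerivAt _ (q x * ψ x + Q x * deriv ψ x) x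
        rw [hd0, image_eq_zero_of_notMem_tsupport hx', mul_zero, mul_zero, add_zero]
        refine (hasDerivAt_const x (0 : ℝ)).congr_of_eventuallyEq ?_
        filter_upwards [hz] with y hy
        simp [hy]
    have e1 := hw ψ hψ hψc hψs
    rw [setIntegral_eq_integral_of_forall_compl_eq_zero] at e1
    · rw [integral_add i1 i3] at e1
      rw [integral_add i3 i2] at e0
      simp only [sub_mul]
      rw [integral_sub i1 i2]; linarith
    · intro x hx
      have hx' : x ∉ tsupport ψ := fun h => hx (hψs h)
      rw [image_eq_zero_of_notMem_tsupport hx',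
        image_eq_zero_of_notMem_tsupport (fun h => hx' (hds h))]; simp)
  refine ⟨fun r => Q r + c, fun r hr => (hQd r hr).add_const c, ?_⟩
  filter_upwards [hc] with r hr h
  linarith [hr h]

/-- If `f` is differentiable with derivative a.e. equal to a continuous function then
it is so everywhere. -/
theorem deriv_eq_of_ae (f f' P : ℝ → ℝ) (hf : ∀ r, 0 < r → HasDerivAt f (f' r) r)
    (hP : ContinuousOn P (Set.Ioi 0)) (hae : ∀ᵐ r, r ∈ Set.Ioi (0 : ℝ) → f' r = P r) :
    ∀ r, 0 < r → f' r = P r := by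
  have hsub : ∀ r, 0 < r → Set.uIcc 1 r ⊆ Set.Ioi (0 : ℝ) := by
    intro r hr x hx
    rw [Set.mem_uIcc] at hx
    simp only [Set.mem_Ioi]
    rcases hx with h | h <;> linarith [h.1]
  have hPi : ∀ r, 0 < r → IntervalIntegrable P volume 1 r := fun r hr =>
    ContinuousOn.intervalIntegrable (hP.mono (hsub r hr))
  have hae' : ∀ r, 0 < r → ∀ᵐ x, x ∈ Set.uIoc 1 r → P x = f' x := by
    intro r hr
    filter_upwards [hae] with x hx h
    exact (hx (hsub r hr (Set.uIoc_subset_uIcc h))).symm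
  have h1 : ∀ r, 0 < r → f r = f 1 + ∫ s in (1 : ℝ)..r, P s := by
    intro r hr
    have : IntervalIntegrable f' volume 1 r := by
      refine (hPi r hr).congr_ae ?_
      rw [Filter.EventuallyEq, ae_restrict_iff' measurableSet_uIoc]
      exact hae' r hr
    have h2 := intervalIntegral.integral_eq_sub_of_hasDerivAt
      (fun x hx => hf x (hsub r hr hx)) this
    rw [intervalIntegral.integral_congr_ae (hae' r hr), h2]; ring
  intro r hr
  have h2 : HasDerivAt (fun r => f 1 + ∫ s in (1 : ℝ)..r, P s) (P r) r := by
    apply HasDerivAt.const_add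
    exact intervalIntegral.integral_hasDerivAt_right (hPi r hr)
      (hP.stronglyMeasurableAtFilter isOpen_Ioi _ hr) (hP.continuousAt (isOpen_Ioi.mem_nhds hr))
  refine (hf r hr).unique (h2.congr_of_eventuallyEq ?_)
  filter_upwards [lt_mem_nhds hr] with s hs
  exact h1 s hs



theorem grad_comp_norm {N : ℕ} (g : ℝ → ℝ) (g' : ℝ) (x : E N) (hx : x ≠ 0)
    (hg : HasDerivAt g g' ‖x‖) :
    HasGradientAt (fun y : E N => g ‖y‖) ((g' / ‖x‖) • x) x := by
  have hx0 : 0 < ‖x‖ := norm_pos_iff.2 hx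
  have h1 : HasFDerivAt (fun y : E N => ‖y‖ ^ 2) (2 • (innerSL ℝ x)) x :=
    (hasStrictFDerivAt_norm_sq x).hasFDerivAt
  have h2 : HasDerivAt (fun s => g (√s)) (g' * (1 / (2 * √(‖x‖ ^ 2)))) (‖x‖ ^ 2) := by
    have h3 : HasDerivAt (fun s : ℝ => √s) (1 / (2 * √(‖x‖ ^ 2))) (‖x‖ ^ 2) :=
      Real.hasDerivAt_sqrt (by positivity)
    have h4 : HasDerivAt g g' (√(‖x‖ ^ 2)) := by
      rwa [Real.sqrt_sq hx0.le]
    exact h4.comp (‖x‖ ^ 2) h3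
  have h3 := h2.comp_hasFDerivAt x h1
  rw [hasGradientAt_iff_hasFDerivAt]
  have e1 : ((fun s => g (√s)) ∘ fun y : E N => ‖y‖ ^ 2) = fun y : E N => g ‖y‖ := by
    ext y; simp
  rw [e1] at h3
  refine h3.congr_fderiv ?_
  ext y
  simp [Real.sqrt_sq hx0.le]
  field_simp

theorem grad_radial {N : ℕ} (u : E N → ℝ) (hu : Differentiable ℝ u) (hr : Radial N u)
    (e : E N) (he : ‖e‖ = 1) :
    (∀ r : ℝ, HasDerivAt (fun r : ℝ => u (r • e)) (deriv (fun r : ℝ => u (r • e)) r) r) ∧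
    (∀ x, u x = u (‖x‖ • e)) ∧
    (∀ x, x ≠ 0 → gradient u x = (deriv (fun r : ℝ => u (r • e)) ‖x‖ / ‖x‖) • x) := by
  have h1 : ∀ r : ℝ, HasDerivAt (fun r : ℝ => u (r • e)) (deriv (fun r : ℝ => u (r • e)) r) r := by
    intro r
    apply DifferentiableAt.hasDerivAt
    have : Differentiable ℝ (fun r : ℝ => u (r • e)) := hu.comp (by fun_prop)
    exact this r
  have h2 : ∀ x, u x = u (‖x‖ • e) := by
    intro x
    apply hr
    simp [norm_smul, he]
  refine ⟨h1, h2, ?_⟩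
  intro x hx
  have h3 := grad_comp_norm (N := N) _ _ x hx (h1 ‖x‖)
  have h4 : (fun y : E N => u (‖y‖ • e)) = u := by ext y; exact (h2 y).symm
  rw [h4] at h3
  exact h3.gradient

theorem memLp_sq_int {N : ℕ} {F : Type*} [NormedAddCommGroup F] {g : E N → F} (hg : MemLp g 2 volume) :
    Integrable (fun x => ‖g x‖ ^ 2) := by
  have := hg.integrable_norm_rpow (by simp) (by simp)
  simpa using this

theorem omega_decay (N : ℕ) (hN : 4 ≤ N) (p Vinf : ℝ) (hp : 1 < p) (ω : E N → ℝ)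
    (hω : IsEqSolution N (fun _ => Vinf) 1 p ω) (hωpos : ∀ x, 0 < ω x)
    (hωrad : Radial N ω) (μ : ℝ) (hμ : 0 < μ) (hμV : μ ^ 2 < Vinf) :
    ∃ K > 0, ∃ r0 > 0, ∀ x : E N, r0 ≤ ‖x‖ →
      ω x ≤ K * exp (-μ * ‖x‖) ∧ ‖gradient ω x‖ ≤ K * exp (-μ * ‖x‖) := by
  obtain ⟨⟨hd, hL2, hG2⟩, hweak⟩ := hω
  let e : E N := EuclideanSpace.single ⟨0, by omega⟩ 1
  have he : ‖e‖ = 1 := by simp [e]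
  have : Nontrivial (E N) := ⟨e, 0, by intro h; simp [h] at he⟩
  have hdim : Module.finrank ℝ (E N) = N := by simp
  obtain ⟨hf, hωf, hgrad⟩ := grad_radial ω hd hωrad e he
  set f : ℝ → ℝ := fun r => ω (r • e) with hfdef
  set f' : ℝ → ℝ := deriv f with hf'def
  have hfpos : ∀ r, 0 < f r := fun r => hωpos _
  have hfc : Continuous f := by
    rw [continuous_iff_continuousAt]; exact fun r => (hf r).continuousAt
  have hωf' : ∀ x, ω x = f ‖x‖ := hωf
  have hgn : ∀ x, x ≠ 0 → ‖gradient ω x‖ = |f' ‖x‖| := by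
    intro x hx
    have : 0 < ‖x‖ := norm_pos_iff.2 hx
    rw [hgrad x hx, norm_smul, norm_div, Real.norm_eq_abs, norm_norm]
    field_simp
  have hae0 : ∀ᵐ x : E N, x ≠ 0 := by simp [ae_iff]
  -- L² facts on the half line
  have hI1 : IntegrableOn (fun r : ℝ => r ^ (N - 1) * f r ^ 2) (Set.Ioi 0) := by
    have h1 : Integrable (fun x : E N => f ‖x‖ ^ 2) := by
      have := memLp_sq_int hL2
      refine this.congr (ae_of_all _ fun x => ?_)
      simp [hωf' x]
    have := (integrable_fun_norm_addHaar (volume : Measure (E N)) (f := fun r => f r ^ 2)).1 h1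
    rw [hdim] at this
    simpa using this
  have hI2 : IntegrableOn (fun r : ℝ => r ^ (N - 1) * f' r ^ 2) (Set.Ioi 0) := by
    have h1 : Integrable (fun x : E N => f' ‖x‖ ^ 2) := by
      have := memLp_sq_int hG2
      refine this.congr ?_
      filter_upwards [hae0] with x hx
      rw [hgn x hx, sq_abs]
    have := (integrable_fun_norm_addHaar (volume : Measure (E N)) (f := fun r => f' r ^ 2)).1 h1
    rw [hdim] at this
    simpa using this
  have hf'm : Measurable f' := measurable_deriv f
  have hmul : IntegrableOn (fun r : ℝ => r ^ (N - 1) * (f r ^ 2 + f' r ^ 2)) (Set.Ioi 0) := by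
    refine (hI1.add hI2).congr (ae_of_all _ fun r => ?_)
    simp; ring
  -- decay at infinity
  have hlim : Tendsto f atTop (𝓝 0) := by
    have hsub : Set.Ioi (1 : ℝ) ⊆ Set.Ioi 0 := Set.Ioi_subset_Ioi zero_le_one
    have h1 : IntegrableOn (fun r => f r ^ 2) (Set.Ioi 1) := by
      refine Integrable.mono' (hmul.mono_set hsub) (by fun_prop) ?_
      rw [ae_restrict_iff' measurableSet_Ioi]
      refine ae_of_all _ fun r hr => ?_
      have : 1 ≤ r ^ (N - 1) := one_le_pow₀ (le_of_lt hr)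
      rw [Real.norm_of_nonneg (by positivity)]
      nlinarith [sq_nonneg (f r), sq_nonneg (f' r)]
    have h2 : IntegrableOn (fun r => 2 * f r * f' r) (Set.Ioi 1) := by
      refine Integrable.mono' (hmul.mono_set hsub) (by fun_prop) ?_
      rw [ae_restrict_iff' measurableSet_Ioi]
      refine ae_of_all _ fun r hr => ?_
      have : 1 ≤ r ^ (N - 1) := one_le_pow₀ (le_of_lt hr)
      rw [Real.norm_eq_abs]
      have h5 : |2 * f r * f' r| ≤ f r ^ 2 + f' r ^ 2 := by
        rw [abs_le]
        constructor <;> nlinarith [sq_nonneg (f r - f' r), sq_nonneg (f r + f' r)]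
      nlinarith [sq_nonneg (f r), sq_nonneg (f' r)]
    have h3 : Tendsto (fun r => f r ^ 2) atTop (𝓝 0) := by
      apply tendsto_zero_of_hasDerivAt_of_integrableOn_Ioi (a := 1) (f' := fun r => 2 * f r * f' r) _ h2 h1
      intro x hx
      have := (hf x).fun_pow 2
      exact this.congr_deriv (by simp)
    have h4 := h3.sqrt
    simp only [Real.sqrt_zero] at h4
    refine h4.congr fun r => ?_
    exact Real.sqrt_sq (hfpos r).le
  -- weak equation in radial form
  set q : ℝ → ℝ := fun r => r ^ (N - 1) * (Vinf * f r - f r ^ (2 * p - 2) * f r) with hqdef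
  set H : ℝ → ℝ := fun r => r ^ (N - 1) * f' r with hHdef
  have hfr : Continuous (fun r => f r ^ (2 * p - 2)) :=
    hfc.rpow_const (fun r => Or.inl (hfpos r).ne')
  have hqc : Continuous q := by
    simp only [hqdef]; fun_prop
  have hHl : LocallyIntegrableOn H (Set.Ioi 0) := by
    have h1 : LocallyIntegrableOn (fun r : ℝ => r ^ (N - 1) * f' r ^ 2 + r ^ (N - 1)) (Set.Ioi 0) :=
      hI2.locallyIntegrableOn.add
        ((by fun_prop : Continuous fun r : ℝ => r ^ (N - 1)).locallyIntegrable.locallyIntegrableOn _)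
    rw [locallyIntegrableOn_iff isOpen_Ioi.isLocallyClosed] at h1 ⊢
    intro k hk hkc
    refine Integrable.mono' (h1 k hk hkc) (by fun_prop) ?_
    rw [ae_restrict_iff' hkc.measurableSet]
    refine ae_of_all _ fun r hr => ?_
    have hr0 : 0 < r := hk hr
    have : 0 < r ^ (N - 1) := by positivity
    rw [hHdef]
    simp only [norm_mul]
    rw [Real.norm_of_nonneg this.le, Real.norm_eq_abs]
    have : |f' r| ≤ f' r ^ 2 + 1 := by
      rw [← sq_abs]
      nlinarith [sq_nonneg (|f' r| - 1), abs_nonneg (f' r)]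
    nlinarith
  have hweak1 : ∀ ψ : ℝ → ℝ, ContDiff ℝ (⊤ : ℕ∞) ψ → HasCompactSupport ψ →
      tsupport ψ ⊆ Set.Ioi 0 → ∫ r in Set.Ioi 0, (H r * deriv ψ r + q r * ψ r) = 0 := by
    intro ψ hψ hψc hψs
    have hdc : Continuous (deriv ψ) := (contDiff_infty_iff_deriv.1 hψ).2.continuous
    have hds : tsupport (deriv ψ) ⊆ tsupport ψ :=
      closure_minimal (support_deriv_subset) (isClosed_tsupport _)
    have hdcs : HasCompactSupport (deriv ψ) := hψc.deriv
    have h0 : (0 : ℝ) ∉ tsupport ψ := fun h => lt_irrefl (0 : ℝ) (hψs h)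
    have hz : ψ =ᶠ[𝓝 0] 0 := notMem_tsupport_iff_eventuallyEq.1 h0
    have hzE : (fun x : E N => ψ ‖x‖) =ᶠ[𝓝 0] 0 := by
      have : Tendsto (fun x : E N => ‖x‖) (𝓝 0) (𝓝 0) := by
        simpa using (continuous_norm (E := E N)).tendsto 0
      exact this.eventually hz
    have hψd : ∀ r, HasDerivAt ψ (deriv ψ r) r :=
      fun r => ((hψ.differentiable (by simp)) r).hasDerivAt
    have htest : IsTest N (fun x => ψ ‖x‖) := by
      constructor
      · rw [contDiff_iff_contDiffAt]
        intro x
        by_cases hx : x = 0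
        · subst hx
          exact contDiffAt_const.congr_of_eventuallyEq hzE
        · exact hψ.contDiffAt.comp x (contDiffAt_norm ℝ hx)
      · obtain ⟨R, hR⟩ := hψc.isCompact.isBounded.subset_closedBall 0
        apply HasCompactSupport.intro (isCompact_closedBall (0 : E N) R)
        intro x hx
        apply image_eq_zero_of_notMem_tsupport
        intro h
        apply hx
        have := hR h
        simpa using this
    have hw := hweak _ htest
    have hgv : ∀ x : E N, ⟪gradient ω x, gradient (fun x : E N => ψ ‖x‖) x⟫ = f' ‖x‖ * deriv ψ ‖x‖ := by
      intro x
      by_cases hx : x = 0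
      · subst hx
        have e1 : gradient (fun x : E N => ψ ‖x‖) 0 = 0 := by
          unfold gradient
          rw [hzE.fderiv_eq]; simp
        have e2 : deriv ψ 0 = 0 := by rw [hz.deriv_eq]; simp
        simp [e1, e2]
      · rw [hgrad x hx, (grad_comp_norm ψ _ x hx (hψd _)).gradient, inner_smul_left, inner_smul_right,
          real_inner_self_eq_norm_sq]
        have : 0 < ‖x‖ := norm_pos_iff.2 hx
        simp
        field_simp
    have el : ∀ x : E N, ⟪gradient ω x, gradient (fun x : E N => ψ ‖x‖) x⟫ + Vinf * ω x * ψ ‖x‖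
        = (fun r => f' r * deriv ψ r + Vinf * f r * ψ r) ‖x‖ := by
      intro x; rw [hgv, hωf' x]
    have er : ∀ x : E N, |ω x| ^ (2 * p - 2) * ω x * ψ ‖x‖
        = (fun r => f r ^ (2 * p - 2) * f r * ψ r) ‖x‖ := by
      intro x; rw [hωf' x, abs_of_pos (hfpos _)]
    simp_rw [el, er] at hw
    rw [integral_fun_norm_addHaar volume (fun r => f' r * deriv ψ r + Vinf * f r * ψ r),
      integral_fun_norm_addHaar volume (fun r => f r ^ (2 * p - 2) * f r * ψ r), hdim, one_mul] at hw
    have hb : 0 < (volume : Measure (E N)).real (Metric.ball 0 1) := by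
      apply ENNReal.toReal_pos
      · exact (Metric.measure_ball_pos _ _ one_pos).ne'
      · exact measure_ball_lt_top.ne
    simp only [nsmul_eq_mul, smul_eq_mul] at hw
    have hNne : (N : ℝ) ≠ 0 := by positivity
    have hw2 := mul_left_cancel₀ hb.ne' (mul_left_cancel₀ hNne hw)
    have i1 := (int_loc hHl hdc hdcs (hds.trans hψs)).integrableOn (s := Set.Ioi 0)
    have i2 := (int_loc (H := fun r => r ^ (N - 1) * (Vinf * f r))
      ((by fun_prop : Continuous fun r : ℝ => r ^ (N - 1) * (Vinf * f r)).locallyIntegrable.locallyIntegrableOn _)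
      hψ.continuous hψc hψs).integrableOn (s := Set.Ioi 0)
    have i3 := (int_loc (H := fun r => r ^ (N - 1) * (f r ^ (2 * p - 2) * f r))
      ((by fun_prop : Continuous fun r : ℝ => r ^ (N - 1) * (f r ^ (2 * p - 2) * f r)).locallyIntegrable.locallyIntegrableOn _)
      hψ.continuous hψc hψs).integrableOn (s := Set.Ioi 0)
    have e3 : ∀ r, H r * deriv ψ r + q r * ψ r = (H r * deriv ψ r + r ^ (N - 1) * (Vinf * f r) * ψ r) -
        r ^ (N - 1) * (f r ^ (2 * p - 2) * f r) * ψ r := by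
      intro r; simp only [hqdef]; ring
    simp_rw [e3]
    have e4 := integral_sub (i1.add i2) i3
    simp only [Pi.add_apply] at e4
    rw [e4, sub_eq_zero]
    refine Eq.trans ?_ (hw2.trans ?_)
    · congr 1; ext r; simp only [hHdef]; ring
    · congr 1; ext r; ring
  obtain ⟨Q, hQd, hQae⟩ := dbr H q hHl hqc.continuousOn hweak1
  set P : ℝ → ℝ := fun r => Q r / r ^ (N - 1) with hPdef
  have hPc : ContinuousOn P (Set.Ioi 0) := by
    apply ContinuousOn.div
    · exact fun r hr => (hQd r hr).continuousAt.continuousWithinAt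
    · fun_prop
    · intro r hr
      have : 0 < r := hr
      positivity
  have hPe : ∀ r, 0 < r → f' r = P r := by
    apply deriv_eq_of_ae f f' P (fun r _ => hf r) hPc
    filter_upwards [hQae] with r hr hr0
    have h0 : 0 < r := hr0
    simp only [hPdef]
    rw [← hr hr0, hHdef]
    field_simp
  obtain ⟨K, hK, r0, hr0, hdec⟩ := ode_decay (N - 1) f f' Vinf p μ hp (fun r _ => hfpos r)
    (fun r _ => hf r) (by
      intro r hr
      refine (hQd r hr).congr_of_eventuallyEq ?_
      filter_upwards [lt_mem_nhds hr] with s hs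
      rw [hPe s hs, hPdef]
      field_simp) hlim hμ hμV
  refine ⟨K, hK, r0, hr0, fun x hx => ?_⟩
  have hx0 : x ≠ 0 := norm_pos_iff.1 (lt_of_lt_of_le hr0 hx)
  rw [hωf' x, hgn x hx0]
  exact hdec _ hx



/-- The truncation of `ω` at radius `r`. -/
noncomputable def trunc (N : ℕ) (ω χ : E N → ℝ) (r : ℝ) (x : E N) : ℝ := χ (r⁻¹ • x) * ω x

theorem grad_trunc {N : ℕ} {ω χ : E N → ℝ} (r : ℝ) (hω : Differentiable ℝ ω)
    (hχ : Differentiable ℝ χ) (x : E N) :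
    HasGradientAt (trunc N ω χ r)
      (χ (r⁻¹ • x) • gradient ω x + (ω x * r⁻¹) • gradient χ (r⁻¹ • x)) x := by
  have h1 := (hω x).hasGradientAt.hasFDerivAt
  have h2 := (hχ (r⁻¹ • x)).hasGradientAt.hasFDerivAt
  have h3 : HasFDerivAt (fun y : E N => r⁻¹ • y) (r⁻¹ • ContinuousLinearMap.id ℝ (E N)) x :=
    (hasFDerivAt_id x).const_smul r⁻¹
  have h4 := (h2.comp x h3).mul h1
  rw [hasGradientAt_iff_hasFDerivAt]
  refine h4.congr_fderiv ?_
  ext y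
  simp
  ring

theorem grad_zero_of_zero {N : ℕ} {χ : E N → ℝ} (hχ01 : ∀ x, 0 ≤ χ x ∧ χ x ≤ 1) {y : E N}
    (hy : χ y = 0 ∨ χ y = 1) : gradient χ y = 0 := by
  unfold gradient
  rcases hy with hy | hy
  · have : IsLocalMin χ y := Filter.Eventually.of_forall fun z => by rw [hy]; exact (hχ01 z).1
    rw [this.fderiv_eq_zero]; simp
  · have : IsLocalMax χ y := Filter.Eventually.of_forall fun z => by rw [hy]; exact (hχ01 z).2
    rw [this.fderiv_eq_zero]; simp

theorem continuous_gradient {N : ℕ} {χ : E N → ℝ} (hχ : ContDiff ℝ (⊤ : ℕ∞) χ) :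
    Continuous (fun x => gradient χ x) := by
  unfold gradient
  exact (LinearIsometryEquiv.continuous _).comp (hχ.continuous_fderiv (by simp))

theorem grad_bounded {N : ℕ} {χ : E N → ℝ} (hχ : ContDiff ℝ (⊤ : ℕ∞) χ)
    (hχ01 : ∀ x, 0 ≤ χ x ∧ χ x ≤ 1) (hχ0 : ∀ x : E N, 1 ≤ ‖x‖ → χ x = 0) :
    ∃ M ≥ 0, ∀ x, ‖gradient χ x‖ ≤ M := by
  obtain ⟨M, hM⟩ := (isCompact_closedBall (0 : E N) 1).exists_bound_of_continuousOn
    (continuous_gradient hχ).continuousOn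
  refine ⟨max M 0, le_max_right _ _, fun x => ?_⟩
  by_cases hx : ‖x‖ ≤ 1
  · exact (hM x (by simpa using hx)).trans (le_max_left _ _)
  · rw [grad_zero_of_zero hχ01 (Or.inl (hχ0 x (by linarith)))]
    simp

theorem trunc_H1 {N : ℕ} {ω χ : E N → ℝ} {r : ℝ} (hω : MemH1 N ω)
    (hχ : ContDiff ℝ (⊤ : ℕ∞) χ)
    (hχ01 : ∀ x, 0 ≤ χ x ∧ χ x ≤ 1) (hχ0 : ∀ x : E N, 1 ≤ ‖x‖ → χ x = 0) :
    MemH1 N (trunc N ω χ r) := by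
  obtain ⟨hd, hL, hG⟩ := hω
  have hχd : Differentiable ℝ χ := hχ.differentiable (by simp)
  have hdt : Differentiable ℝ (trunc N ω χ r) := fun x =>
    (grad_trunc r hd hχd x).differentiableAt
  obtain ⟨M, hM0, hM⟩ := grad_bounded hχ hχ01 hχ0
  refine ⟨hdt, ?_, ?_⟩
  · refine hL.of_le hdt.continuous.aestronglyMeasurable (ae_of_all _ fun x => ?_)
    simp only [trunc, norm_mul]
    have := hχ01 (r⁻¹ • x)
    rw [Real.norm_of_nonneg this.1]
    nlinarith [norm_nonneg (ω x)]
  · have e : (fun x => gradient (trunc N ω χ r) x) = fun x =>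
        (χ (r⁻¹ • x) • gradient ω x + (ω x * r⁻¹) • gradient χ (r⁻¹ • x)) :=
      funext fun x => (grad_trunc r hd hχd x).gradient
    rw [e]
    have c1 : Continuous fun x : E N => χ (r⁻¹ • x) := hχ.continuous.comp (by fun_prop)
    have c2 : Continuous fun x : E N => gradient χ (r⁻¹ • x) :=
      (continuous_gradient hχ).comp (by fun_prop)
    have c3 := hd.continuous
    refine MemLp.add ?_ ?_
    · refine hG.of_le (c1.aestronglyMeasurable.smul hG.1) (ae_of_all _ fun x => ?_)
      have := hχ01 (r⁻¹ • x)
      rw [norm_smul, Real.norm_of_nonneg this.1]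
      nlinarith [norm_nonneg (gradient ω x)]
    · refine (hL.const_mul (|r⁻¹| * M)).of_le (by fun_prop) (ae_of_all _ fun x => ?_)
      have := hM (r⁻¹ • x)
      rw [norm_smul, norm_mul, norm_mul, Real.norm_eq_abs r⁻¹, Real.norm_of_nonneg (by positivity : 0 ≤ |r⁻¹| * M)]
      have h5 : ‖ω x‖ * |r⁻¹| * ‖gradient χ (r⁻¹ • x)‖ ≤ ‖ω x‖ * |r⁻¹| * M := by gcongr
      linarith

/-- Gradient is given in the core by that of `ω`. -/
theorem trunc_core {N : ℕ} {ω χ : E N → ℝ} {r ε : ℝ} (hr : 0 < r) (hω : Differentiable ℝ ω)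
    (hχ : Differentiable ℝ χ) (hχ01 : ∀ x, 0 ≤ χ x ∧ χ x ≤ 1)
    (hχ1 : ∀ x : E N, ‖x‖ ≤ 1 - ε → χ x = 1) (x : E N) (hx : ‖x‖ ≤ (1 - ε) * r) :
    trunc N ω χ r x = ω x ∧ gradient (trunc N ω χ r) x = gradient ω x := by
  have h1 : χ (r⁻¹ • x) = 1 := by
    apply hχ1
    rw [norm_smul, Real.norm_of_nonneg (by positivity), inv_mul_le_iff₀ hr]
    linarith
  constructor
  · simp [trunc, h1]
  · rw [(grad_trunc r hω hχ x).gradient, h1, grad_zero_of_zero hχ01 (Or.inr h1)]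
    simp

theorem trunc_out {N : ℕ} {ω χ : E N → ℝ} {r : ℝ} (hr : 0 < r) (hω : Differentiable ℝ ω)
    (hχ : Differentiable ℝ χ) (hχ01 : ∀ x, 0 ≤ χ x ∧ χ x ≤ 1)
    (hχ0 : ∀ x : E N, 1 ≤ ‖x‖ → χ x = 0) (x : E N) (hx : r ≤ ‖x‖) :
    trunc N ω χ r x = 0 ∧ gradient (trunc N ω χ r) x = 0 := by
  have h1 : χ (r⁻¹ • x) = 0 := by
    apply hχ0
    rw [norm_smul, Real.norm_of_nonneg (by positivity), le_inv_mul_iff₀ hr]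
    linarith
  constructor
  · simp [trunc, h1]
  · rw [(grad_trunc r hω hχ x).gradient, h1, grad_zero_of_zero hχ01 (Or.inl h1)]
    simp

theorem trunc_grad_le {N : ℕ} {ω χ : E N → ℝ} {r M : ℝ} (hr : 1 ≤ r) (hω : Differentiable ℝ ω)
    (hχ : Differentiable ℝ χ) (hχ01 : ∀ x, 0 ≤ χ x ∧ χ x ≤ 1)
    (hM : ∀ x, ‖gradient χ x‖ ≤ M) (x : E N) :
    ‖gradient (trunc N ω χ r) x‖ ^ 2 ≤ 2 * ‖gradient ω x‖ ^ 2 + 2 * M ^ 2 * ω x ^ 2 := by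
  rw [(grad_trunc r hω hχ x).gradient]
  have h1 : ‖χ (r⁻¹ • x) • gradient ω x + (ω x * r⁻¹) • gradient χ (r⁻¹ • x)‖ ≤
      ‖gradient ω x‖ + |ω x| * M := by
    refine (norm_add_le _ _).trans ?_
    have := hχ01 (r⁻¹ • x)
    rw [norm_smul, norm_smul, Real.norm_of_nonneg this.1, norm_mul, Real.norm_eq_abs,
      Real.norm_of_nonneg (by positivity)]
    have h2 : r⁻¹ ≤ 1 := inv_le_one_of_one_le₀ hr
    have h3 := hM (r⁻¹ • x)
    have h4 : χ (r⁻¹ • x) * ‖gradient ω x‖ ≤ 1 * ‖gradient ω x‖ := by gcongr; exact this.2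
    have h5 : |ω x| * r⁻¹ * ‖gradient χ (r⁻¹ • x)‖ ≤ |ω x| * 1 * M := by gcongr
    linarith
  calc _ ≤ (‖gradient ω x‖ + |ω x| * M) ^ 2 := by gcongr
    _ ≤ _ := by
      rw [← sq_abs (ω x)]
      nlinarith [sq_nonneg (‖gradient ω x‖ - |ω x| * M)]

theorem exp_norm_integrable (N : ℕ) (c : ℝ) (hc : 0 < c) :
    Integrable (fun x : E N => exp (-c * ‖x‖)) := by
  have h1 : Integrable (fun x : E N => (1 + ‖x‖) ^ (-((N : ℝ) + 1))) := by
    apply integrable_one_add_norm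
    simp
  obtain ⟨B, hB⟩ : ∃ B : ℝ, ∀ s : ℝ, 0 ≤ s → (1 + s) ^ ((N : ℝ) + 1) * exp (-c * s) ≤ B := by
    have h2 := tendsto_rpow_mul_exp_neg_mul_atTop_nhds_zero ((N : ℝ) + 1) c hc
    obtain ⟨s0, hs0⟩ := eventually_atTop.1 (h2.eventually (gt_mem_nhds one_pos))
    have hcont : ContinuousOn (fun s : ℝ => (1 + s) ^ ((N : ℝ) + 1) * exp (-c * s)) (Set.Icc 0 (max s0 0)) := by
      apply ContinuousOn.mul
      · apply ContinuousOn.rpow_const (by fun_prop)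
        intro x hx
        right; positivity
      · fun_prop
    obtain ⟨B, hB⟩ := isCompact_Icc.exists_bound_of_continuousOn hcont
    refine ⟨max B (exp c), fun s hs => ?_⟩
    by_cases h : s ≤ max s0 0
    · exact (le_abs_self _).trans ((hB s ⟨hs, h⟩).trans (le_max_left _ _))
    · have h3 : s0 ≤ s := by
        push Not at h
        exact (le_max_left _ _).trans h.le
      have h4 := hs0 (1 + s) (by linarith)
      refine le_trans ?_ (le_max_right _ _)
      have h5 : exp (-c * s) = exp c * exp (-c * (1 + s)) := by rw [← exp_add]; ring_nf
      rw [h5]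
      nlinarith [exp_pos c]
  refine Integrable.mono' (h1.const_mul B) (by fun_prop) (ae_of_all _ fun x => ?_)
  rw [Real.norm_of_nonneg (exp_pos _).le, Real.rpow_neg (by positivity), ← div_eq_mul_inv,
    le_div_iff₀ (by positivity)]
  have := hB ‖x‖ (norm_nonneg _)
  linarith

/-- Density of the `H¹`-norm of `ω`, outside the ball of radius `s`. -/
noncomputable def tailD (N : ℕ) (ω : E N → ℝ) (s : ℝ) (x : E N) : ℝ :=
  Set.indicator {x : E N | s < ‖x‖} (fun x => ‖gradient ω x‖ ^ 2 + ω x ^ 2) x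

theorem tail_bound (N : ℕ) (hN : 4 ≤ N) (p Vinf : ℝ) (hp : 1 < p) (ω : E N → ℝ)
    (hω : IsEqSolution N (fun _ => Vinf) 1 p ω) (hωpos : ∀ x, 0 < ω x)
    (hωrad : Radial N ω) (hV : 0 < Vinf) (ν : ℝ) (hν : 0 < ν) (hνV : ν < 2 * √Vinf) :
    ∃ K > 0, ∃ s0 > 0, ∀ s ≥ s0, ∫ x, tailD N ω s x ≤ K * exp (-ν * s) := by
  set μ := (ν / 2 + √Vinf) / 2 with hμ
  have hs : 0 < √Vinf := Real.sqrt_pos.2 hV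
  have hμ0 : 0 < μ := by positivity
  have hμV : μ ^ 2 < Vinf := by
    have : μ < √Vinf := by rw [hμ]; linarith
    calc μ ^ 2 < √Vinf ^ 2 := by gcongr
      _ = Vinf := Real.sq_sqrt hV.le
  have hc : 0 < 2 * μ - ν := by rw [hμ]; linarith
  obtain ⟨K, hK, r0, hr0, hdec⟩ := omega_decay N hN p Vinf hp ω hω hωpos hωrad μ hμ0 hμV
  have hi := exp_norm_integrable N _ hc
  have hpos : 0 < ∫ x : E N, exp (-(2 * μ - ν) * ‖x‖) := by
    rw [integral_pos_iff_support_of_nonneg (fun x => (exp_pos _).le) hi]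
    have : Function.support (fun x : E N => exp (-(2 * μ - ν) * ‖x‖)) = Set.univ := by
      ext x; simp [(exp_pos _).ne']
    rw [this]
    exact Measure.measure_univ_pos.2 (NeZero.ne _)
  refine ⟨2 * K ^ 2 * ∫ x : E N, exp (-(2 * μ - ν) * ‖x‖), by positivity, r0, hr0, fun s hs => ?_⟩
  have e : 2 * K ^ 2 * (∫ x : E N, exp (-(2 * μ - ν) * ‖x‖)) * exp (-ν * s) =
      ∫ x : E N, (2 * K ^ 2 * exp (-ν * s)) * exp (-(2 * μ - ν) * ‖x‖) := by
    rw [integral_const_mul]; ring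
  rw [e]
  apply integral_mono_of_nonneg
  · refine ae_of_all _ fun x => ?_
    apply Set.indicator_nonneg
    intro x _; positivity
  · exact hi.const_mul _
  · refine ae_of_all _ fun x => ?_
    simp only [tailD]
    by_cases hx : s < ‖x‖
    · rw [Set.indicator_of_mem (by exact hx)]
      obtain ⟨h1, h2⟩ := hdec x (by linarith)
      have h3 : ω x ^ 2 ≤ (K * exp (-μ * ‖x‖)) ^ 2 := by
        have := (hωpos x).le
        gcongr
      have h4 : ‖gradient ω x‖ ^ 2 ≤ (K * exp (-μ * ‖x‖)) ^ 2 := by gcongr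
      have h5 : (K * exp (-μ * ‖x‖)) ^ 2 = K ^ 2 * (exp (-ν * ‖x‖) * exp (-(2 * μ - ν) * ‖x‖)) := by
        rw [mul_pow, ← exp_nat_mul, ← exp_add]; congr 2; push_cast; ring
      have h6 : exp (-ν * ‖x‖) ≤ exp (-ν * s) := by
        apply Real.exp_le_exp.2; nlinarith
      have h7 : K ^ 2 * (exp (-ν * ‖x‖) * exp (-(2 * μ - ν) * ‖x‖)) ≤
        K ^ 2 * (exp (-ν * s) * exp (-(2 * μ - ν) * ‖x‖)) := by gcongr
      linarith
    · rw [Set.indicator_of_notMem (by exact hx)]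
      positivity

theorem omega_bounded (N : ℕ) (hN : 4 ≤ N) (p Vinf : ℝ) (hp : 1 < p) (ω : E N → ℝ)
    (hω : IsEqSolution N (fun _ => Vinf) 1 p ω) (hωpos : ∀ x, 0 < ω x)
    (hωrad : Radial N ω) (hV : 0 < Vinf) : ∃ B > 0, ∀ x, ω x ≤ B := by
  have hs : 0 < √Vinf := Real.sqrt_pos.2 hV
  obtain ⟨K, hK, r0, hr0, hdec⟩ := omega_decay N hN p Vinf hp ω hω hωpos hωrad (√Vinf / 2)
    (by positivity) (by rw [div_pow, Real.sq_sqrt hV.le]; linarith)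
  obtain ⟨M, hM⟩ := (isCompact_closedBall (0 : E N) r0).exists_bound_of_continuousOn
    hω.1.1.continuous.continuousOn
  refine ⟨max M K, lt_of_lt_of_le hK (le_max_right _ _), fun x => ?_⟩
  by_cases hx : ‖x‖ ≤ r0
  · exact (le_abs_self _).trans ((hM x (by simpa using hx)).trans (le_max_left _ _))
  · refine ((hdec x (by linarith)).1.trans ?_).trans (le_max_right _ _)
    have : exp (-(√Vinf / 2) * ‖x‖) ≤ 1 := by
      rw [Real.exp_le_one_iff]
      have := norm_nonneg x
      nlinarith
    nlinarith



set_option maxHeartbeats 2000000 in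
theorem one_bump (N : ℕ) (hN : 4 ≤ N) (p : ℝ) (hp : 1 < p)
    (V : E N → ℝ) (Vinf : ℝ) (hVcont : Continuous V) (hV2 : HypV2 N V Vinf)
    (lam C₀ R₀ : ℝ) (hC₀ : 0 < C₀) (hlam0 : 0 < lam)
    (hV3 : ∀ x : E N, R₀ ≤ ‖x‖ →
      V x ≤ Vinf - C₀ * Real.exp (-lam * Real.sqrt Vinf * ‖x‖))
    (ε : ℝ) (hε1 : ε < 1) (ϱ : ℝ) (hϱ0 : 0 < ϱ) (hϱ1 : ϱ < 1)
    (hkey : lam < 2 * (1 - ε) * ϱ)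
    (ω : E N → ℝ) (hω : IsEqSolution N (fun _ => Vinf) 1 p ω) (hωpos : ∀ x, 0 < ω x)
    (hωrad : Radial N ω)
    (hωNehari : normVSq N (fun _ => Vinf) ω = ∫ x, |ω x| ^ (2 * p))
    (χ : E N → ℝ) (hχsmooth : ContDiff ℝ (⊤ : ℕ∞) χ)
    (hχ01 : ∀ x, 0 ≤ χ x ∧ χ x ≤ 1)
    (hχ1 : ∀ x : E N, ‖x‖ ≤ 1 - ε → χ x = 1)
    (hχ0 : ∀ x : E N, 1 ≤ ‖x‖ → χ x = 0) :
    ∃ c₁ > 0, ∃ m > 0, ∀ δ > 0, ∃ R₁ > 0, ∀ R ≥ R₁,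
      (∀ c : E N, ‖c‖ = R →
        Integrable (fun y => ‖gradient (trunc N ω χ (ϱ * R)) y‖ ^ 2 +
          V (y + c) * trunc N ω χ (ϱ * R) y ^ 2) ∧
        m ≤ ∫ y, (‖gradient (trunc N ω χ (ϱ * R)) y‖ ^ 2 +
          V (y + c) * trunc N ω χ (ϱ * R) y ^ 2) ∧
        ∫ y, (‖gradient (trunc N ω χ (ϱ * R)) y‖ ^ 2 +
          V (y + c) * trunc N ω χ (ϱ * R) y ^ 2) ≤
          (∫ x, |ω x| ^ (2 * p)) - (c₁ - δ) * exp (-lam * √Vinf * R)) ∧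
      Integrable (fun y => |trunc N ω χ (ϱ * R) y| ^ (2 * p)) ∧
      (∫ x, |ω x| ^ (2 * p)) - δ * exp (-lam * √Vinf * R) ≤
        ∫ y, |trunc N ω χ (ϱ * R) y| ^ (2 * p) ∧
      ∫ y, |trunc N ω χ (ϱ * R) y| ^ (2 * p) ≤ ∫ x, |ω x| ^ (2 * p) := by
  obtain ⟨⟨v, hv, hVv⟩, hVi, -⟩ := hV2
  have hsV : 0 < √Vinf := Real.sqrt_pos.2 hVi
  set κ := lam * √Vinf with hκ
  have hκ0 : 0 < κ := by positivity
  obtain ⟨M, hM0, hM⟩ := grad_bounded hχsmooth hχ01 hχ0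
  have hχd : Differentiable ℝ χ := hχsmooth.differentiable (by simp)
  obtain ⟨hd, hL, hG⟩ := hω.1
  obtain ⟨B, hB0, hB⟩ := omega_bounded N hN p Vinf hp ω hω hωpos hωrad hVi
  -- the exponent
  obtain ⟨ν, hν0, hνV, hνκ⟩ : ∃ ν, 0 < ν ∧ ν < 2 * √Vinf ∧ κ < ν * ((1 - ε) * ϱ) := by
    have hpos : 0 < (1 - ε) * ϱ := mul_pos (by linarith) hϱ0
    have h1 : κ / ((1 - ε) * ϱ) < 2 * √Vinf := by
      rw [div_lt_iff₀ hpos, hκ]; nlinarith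
    obtain ⟨ν, h2, h3⟩ := exists_between h1
    refine ⟨ν, lt_trans (by positivity) h2, h3, ?_⟩
    rwa [div_lt_iff₀ hpos] at h2
  obtain ⟨K, hK, s0, hs0, htail⟩ := tail_bound N hN p Vinf hp ω hω hωpos hωrad hVi ν hν0 hνV
  -- integrability facts
  have iω : Integrable (fun x => ω x ^ 2) := by simpa using memLp_sq_int hL
  have ig : Integrable (fun x => ‖gradient ω x‖ ^ 2) := memLp_sq_int hG
  have iD : ∀ s, Integrable (tailD N ω s) := fun s =>
    (ig.add iω).indicator (measurableSet_lt measurable_const measurable_norm)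
  have hD0 : ∀ s x, 0 ≤ tailD N ω s x := fun s x => by
    apply Set.indicator_nonneg
    intro x _; positivity
  have ip : Integrable (fun x => |ω x| ^ (2 * p)) := by
    refine Integrable.mono' (iω.const_mul (B ^ (2 * p - 2))) ?_ (ae_of_all _ fun x => ?_)
    · exact (hd.continuous.abs.rpow_const (fun x => Or.inr (by linarith))).aestronglyMeasurable
    · have h0 := hωpos x
      rw [Real.norm_of_nonneg (by positivity), abs_of_pos h0,
        show (2 * p) = (2 * p - 2) + 2 by ring, Real.rpow_add h0]
      have : ω x ^ (2 : ℝ) = ω x ^ 2 := by norm_cast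
      rw [this, show 2 * p - 2 + 2 - 2 = 2 * p - 2 by ring]
      exact mul_le_mul_of_nonneg_right (Real.rpow_le_rpow h0.le (hB x) (by linarith)) (sq_nonneg _)
  set m0 := ∫ x in Metric.closedBall (0 : E N) 1, ω x ^ 2 with hm0
  have hm0p : 0 < m0 := by
    rw [hm0, setIntegral_pos_iff_support_of_nonneg_ae]
    · have : Function.support (fun x => ω x ^ 2) = Set.univ := by
        ext x; simp [(hωpos x).ne']
      rw [this, Set.univ_inter]
      exact Metric.measure_closedBall_pos _ _ one_pos
    · exact ae_of_all _ fun x => sq_nonneg _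
    · exact iω.integrableOn
  set Bind : E N → ℝ := Set.indicator (Metric.closedBall (0 : E N) 1) (fun x => ω x ^ 2) with hBind
  have iB : Integrable Bind := iω.indicator measurableSet_closedBall
  have hBm : ∫ x, Bind x = m0 := integral_indicator measurableSet_closedBall
  set C := 2 + 2 * M ^ 2 + B ^ (2 * p - 2) with hC
  have hBp : 0 < B ^ (2 * p - 2) := by positivity
  have hCp : 0 < C := by positivity
  set A := ∫ x, |ω x| ^ (2 * p) with hA
  have hA' : ∫ x, (‖gradient ω x‖ ^ 2 + Vinf * ω x ^ 2) = A := hωNehari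
  refine ⟨C₀ * exp (-κ) * m0, by positivity, v * m0, by positivity, fun δ hδ => ?_⟩
  -- choose R₁
  have hη : 0 < ν * ((1 - ε) * ϱ) - κ := by linarith
  have hlim : Tendsto (fun R : ℝ => C * K * exp (-(ν * ((1 - ε) * ϱ) - κ) * R)) atTop (𝓝 0) := by
    have h1 : Tendsto (fun R : ℝ => (ν * ((1 - ε) * ϱ) - κ) * R) atTop atTop :=
      tendsto_id.const_mul_atTop hη
    have h2 := (Real.tendsto_exp_neg_atTop_nhds_zero.comp h1).const_mul (C * K)
    rw [mul_zero] at h2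
    refine h2.congr fun R => ?_
    simp only [Function.comp]
    congr 2; ring
  have hpos1 : 0 < (1 - ε) * ϱ := mul_pos (by linarith) hϱ0
  have hev : ∀ᶠ R : ℝ in atTop, C * K * exp (-(ν * ((1 - ε) * ϱ) - κ) * R) < δ ∧
      max s0 1 ≤ (1 - ε) * ϱ * R ∧ 1 ≤ ϱ * R ∧ R₀ ≤ (1 - ϱ) * R ∧ 1 ≤ R := by
    refine (hlim.eventually (gt_mem_nhds hδ)).and (Eventually.and ?_ (Eventually.and ?_ (Eventually.and ?_ ?_)))
    · exact (tendsto_id.const_mul_atTop hpos1).eventually_ge_atTop _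
    · exact (tendsto_id.const_mul_atTop hϱ0).eventually_ge_atTop _
    · exact (tendsto_id.const_mul_atTop (by linarith : 0 < 1 - ϱ)).eventually_ge_atTop _
    · exact eventually_ge_atTop _
  obtain ⟨R₁, hR₁⟩ := eventually_atTop.1 hev
  refine ⟨max R₁ 1, by positivity, fun R hR => ?_⟩
  obtain ⟨hRδ, hRs, hRr, hRR, hR1⟩ := hR₁ R ((le_max_left _ _).trans hR)
  set r := ϱ * R with hr
  have hr0 : 0 < r := by linarith
  set u := trunc N ω χ r with hu
  set s := (1 - ε) * r with hs
  have hse : s = (1 - ε) * ϱ * R := by rw [hs, hr]; ring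
  have hsge : s0 ≤ s := by rw [hse]; exact (le_max_left _ _).trans hRs
  have hs1 : 1 ≤ s := by rw [hse]; exact (le_max_right _ _).trans hRs
  have huH := trunc_H1 (r := r) hω.1 hχsmooth hχ01 hχ0
  rw [← hu] at huH
  have hexp : -lam * √Vinf * R = -κ * R := by rw [hκ]; ring
  rw [hexp]
  have hT : C * ∫ x, tailD N ω s x ≤ δ * exp (-κ * R) := by
    have h1 := htail s hsge
    have h2 : exp (-ν * s) = exp (-(ν * ((1 - ε) * ϱ) - κ) * R) * exp (-κ * R) := by
      rw [← exp_add, hse]; congr 1; ring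
    rw [h2] at h1
    calc C * ∫ x, tailD N ω s x ≤ C * (K * (exp (-(ν * ((1 - ε) * ϱ) - κ) * R) * exp (-κ * R))) := by gcongr
      _ = (C * K * exp (-(ν * ((1 - ε) * ϱ) - κ) * R)) * exp (-κ * R) := by ring
      _ ≤ _ := by gcongr
  have hu0 : ∀ x, 0 ≤ u x := fun x => mul_nonneg (hχ01 _).1 (hωpos x).le
  have huω : ∀ x, u x ≤ ω x := fun x => by
    have := (hχ01 (r⁻¹ • x)).2
    have h0 := hωpos x
    simp only [hu, trunc]; nlinarith
  -- pointwise estimate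
  have hpt : ∀ x, ‖gradient u x‖ ^ 2 + Vinf * u x ^ 2 ≤
      ‖gradient ω x‖ ^ 2 + Vinf * ω x ^ 2 + C * tailD N ω s x := by
    intro x
    by_cases hx : s < ‖x‖
    · have h1 := trunc_grad_le hRr hd hχd hχ01 hM x
      have h2 : u x ^ 2 ≤ ω x ^ 2 := by
        exact pow_le_pow_left₀ (hu0 x) (huω x) 2
      have h3 : tailD N ω s x = ‖gradient ω x‖ ^ 2 + ω x ^ 2 := Set.indicator_of_mem (by exact hx) _
      rw [h3]
      rw [← hu] at h1
      have h4 : Vinf * u x ^ 2 ≤ Vinf * ω x ^ 2 := by gcongr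
      have h5 : 0 ≤ ‖gradient ω x‖ ^ 2 := sq_nonneg _
      have h6 : 0 ≤ ω x ^ 2 := sq_nonneg _
      have h7 : 0 ≤ (2 * M ^ 2 + B ^ (2 * p - 2)) * ‖gradient ω x‖ ^ 2 := by positivity
      have h8 : 0 ≤ (2 + B ^ (2 * p - 2)) * ω x ^ 2 := by positivity
      have h9 : C * (‖gradient ω x‖ ^ 2 + ω x ^ 2) = 2 * ‖gradient ω x‖ ^ 2
          + 2 * M ^ 2 * ω x ^ 2 + (2 * M ^ 2 + B ^ (2 * p - 2)) * ‖gradient ω x‖ ^ 2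
          + (2 + B ^ (2 * p - 2)) * ω x ^ 2 := by rw [hC]; ring
      linarith
    · obtain ⟨h1, h2⟩ := trunc_core hr0 hd hχd hχ01 hχ1 x (not_lt.1 hx)
      rw [hu, h1, h2]
      have := mul_nonneg hCp.le (hD0 s x)
      linarith
  have ip' : Integrable (fun y => |u y| ^ (2 * p)) := by
    refine Integrable.mono' ip ?_ (ae_of_all _ fun x => ?_)
    · exact (huH.1.continuous.abs.rpow_const (fun x => Or.inr (by linarith))).aestronglyMeasurable
    · rw [Real.norm_of_nonneg (by positivity), abs_of_nonneg (hu0 x), abs_of_pos (hωpos x)]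
      exact Real.rpow_le_rpow (hu0 x) (huω x) (by linarith)
  refine ⟨fun c hc => ?_, ip', ?_, ?_⟩
  · have iu : Integrable (fun y => ‖gradient u y‖ ^ 2 + V (y + c) * u y ^ 2) := by
      refine (memLp_sq_int huH.2.2).add ?_
      apply Continuous.integrable_of_hasCompactSupport
      · have := huH.1.continuous
        fun_prop
      · apply HasCompactSupport.intro (isCompact_closedBall (0 : E N) r)
        intro x hx
        have hx' : r ≤ ‖x‖ := by
          simp at hx; exact hx.le
        rw [hu, (trunc_out hr0 hd hχd hχ01 hχ0 x hx').1]; simp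
    refine ⟨iu, ?_, ?_⟩
    · rw [← hBm, ← integral_const_mul]
      apply integral_mono (iB.const_mul v) iu
      intro x
      simp only
      have h2 := hVv (x + c)
      have h3 := sq_nonneg (u x)
      by_cases hx : x ∈ Metric.closedBall (0 : E N) 1
      · rw [hBind, Set.indicator_of_mem hx]
        have hx1 : ‖x‖ ≤ 1 := by simpa using hx
        have h1 := (trunc_core hr0 hd hχd hχ01 hχ1 x (hx1.trans hs1)).1
        rw [← hu] at h1
        rw [h1] at h3 ⊢
        have := sq_nonneg ‖gradient u x‖
        nlinarith
      · rw [hBind, Set.indicator_of_notMem hx]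
        have : 0 ≤ V (x + c) * u x ^ 2 := mul_nonneg (by linarith) h3
        have := sq_nonneg ‖gradient u x‖
        linarith
    · have hrhs : ∫ x, ((‖gradient ω x‖ ^ 2 + Vinf * ω x ^ 2) + (C * tailD N ω s x
          - (C₀ * exp (-κ) * exp (-κ * R)) * Bind x)) =
          A + (C * ∫ x, tailD N ω s x) - C₀ * exp (-κ) * exp (-κ * R) * m0 := by
        rw [integral_add, integral_sub, integral_const_mul, integral_const_mul, hA', hBm]
        · ring
        · exact (iD s).const_mul _
        · exact iB.const_mul _
        · exact ig.add (iω.const_mul _)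
        · exact ((iD s).const_mul _).sub (iB.const_mul _)
      have hle : ∫ y, (‖gradient u y‖ ^ 2 + V (y + c) * u y ^ 2) ≤
          ∫ x, ((‖gradient ω x‖ ^ 2 + Vinf * ω x ^ 2) + (C * tailD N ω s x
          - (C₀ * exp (-κ) * exp (-κ * R)) * Bind x)) := by
        apply integral_mono iu
        · exact (ig.add (iω.const_mul _)).add (((iD s).const_mul _).sub (iB.const_mul _))
        intro x
        simp only
        have h1 := hpt x
        have h2 : V (x + c) * u x ^ 2 ≤ Vinf * u x ^ 2 - C₀ * exp (-κ) * exp (-κ * R) * Bind x := by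
          have hu2 := sq_nonneg (u x)
          by_cases hx : x ∈ Metric.closedBall (0 : E N) 1
          · rw [hBind, Set.indicator_of_mem hx]
            have hx1 : ‖x‖ ≤ 1 := by simpa using hx
            have h1 := (trunc_core hr0 hd hχd hχ01 hχ1 x (hx1.trans hs1)).1
            rw [← hu] at h1
            rw [h1] at hu2 ⊢
            have h5 : R - ‖x‖ ≤ ‖x + c‖ := by
              have := norm_sub_norm_le c (-x)
              rw [norm_neg, hc, sub_neg_eq_add, add_comm] at this
              linarith
            have h6 : ‖x + c‖ ≤ 1 + R := (norm_add_le _ _).trans (by linarith)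
            have h7 := hV3 (x + c) (by nlinarith)
            have h8 : exp (-κ) * exp (-κ * R) ≤ exp (-lam * √Vinf * ‖x + c‖) := by
              rw [← exp_add]; apply Real.exp_le_exp.2
              have : -lam * √Vinf * ‖x + c‖ = -κ * ‖x + c‖ := by rw [hκ]; ring
              rw [this]; nlinarith
            have h9 : V (x + c) ≤ Vinf - C₀ * (exp (-κ) * exp (-κ * R)) := by nlinarith
            nlinarith
          · rw [hBind, Set.indicator_of_notMem hx]
            by_cases hxr : r ≤ ‖x‖
            · rw [hu, (trunc_out hr0 hd hχd hχ01 hχ0 x hxr).1]; simp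
            · have h5 : R - ‖x‖ ≤ ‖x + c‖ := by
                have := norm_sub_norm_le c (-x)
                rw [norm_neg, hc, sub_neg_eq_add, add_comm] at this
                linarith
              have h7 := hV3 (x + c) (by nlinarith)
              have h8 : 0 < C₀ * exp (-lam * √Vinf * ‖x + c‖) := by positivity
              nlinarith
        linarith
      rw [hrhs] at hle
      have : (C₀ * exp (-κ) * m0 - δ) * exp (-κ * R) =
        C₀ * exp (-κ) * exp (-κ * R) * m0 - δ * exp (-κ * R) := by ring
      rw [this]
      linarith
  · have h1 : ∫ x, (|ω x| ^ (2 * p) - C * tailD N ω s x) ≤ ∫ y, |u y| ^ (2 * p) := by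
      apply integral_mono (ip.sub ((iD s).const_mul C)) ip'
      intro x
      show |ω x| ^ (2 * p) - C * tailD N ω s x ≤ |u x| ^ (2 * p)
      by_cases hx : s < ‖x‖
      · have h3 : tailD N ω s x = ‖gradient ω x‖ ^ 2 + ω x ^ 2 := Set.indicator_of_mem (by exact hx) _
        have h0 := hωpos x
        have h4 : |ω x| ^ (2 * p) ≤ C * tailD N ω s x := by
          rw [h3, abs_of_pos h0,
            show (2 * p) = (2 * p - 2) + 2 by ring, Real.rpow_add h0]
          have : ω x ^ (2 : ℝ) = ω x ^ 2 := by norm_cast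
          rw [this]
          have h5 : ω x ^ (2 * p - 2) ≤ C := by
            have := Real.rpow_le_rpow h0.le (hB x) (by linarith : 0 ≤ 2 * p - 2)
            rw [hC]; nlinarith [sq_nonneg M]
          have h6 := sq_nonneg ‖gradient ω x‖
          have h7 := sq_nonneg (ω x)
          nlinarith
        have h5 : 0 ≤ |u x| ^ (2 * p) := by positivity
        linarith
      · obtain ⟨h1, h2⟩ := trunc_core hr0 hd hχd hχ01 hχ1 x (not_lt.1 hx)
        rw [hu, h1]
        have := mul_nonneg hCp.le (hD0 s x)
        linarith
    rw [integral_sub ip ((iD s).const_mul C), integral_const_mul] at h1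
    linarith
  · apply integral_mono ip' ip
    intro x
    simp only
    rw [abs_of_nonneg (hu0 x), abs_of_pos (hωpos x)]
    exact Real.rpow_le_rpow (hu0 x) (huω x) (by linarith)



theorem act_add (N : ℕ) (hN : 2 ≤ N) (α : ℝ)
    (θ : EuclideanSpace ℝ (Fin (N - 2)) ≃ₗᵢ[ℝ] EuclideanSpace ℝ (Fin (N - 2))) (x y : E N) :
    act N hN α θ (x + y) = act N hN α θ x + act N hN α θ y := by
  ext i
  have h : (WithLp.toLp 2 fun j : Fin (N - 2) => (x + y) ⟨(j : ℕ) + 2, by have := j.isLt; omega⟩ :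
      EuclideanSpace ℝ (Fin (N - 2))) =
    (WithLp.toLp 2 fun j : Fin (N - 2) => x ⟨(j : ℕ) + 2, by have := j.isLt; omega⟩) +
    (WithLp.toLp 2 fun j : Fin (N - 2) => y ⟨(j : ℕ) + 2, by have := j.isLt; omega⟩) := by
    ext j; simp
  simp only [act, PiLp.add_apply]
  split_ifs
  · ring
  · ring
  · have h2 := congrArg θ h
    rw [map_add] at h2
    exact congrArg (fun z : EuclideanSpace ℝ (Fin (N - 2)) => z ⟨(i : ℕ) - 2, by have := i.isLt; omega⟩) h2

theorem act_smul (N : ℕ) (hN : 2 ≤ N) (α : ℝ)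
    (θ : EuclideanSpace ℝ (Fin (N - 2)) ≃ₗᵢ[ℝ] EuclideanSpace ℝ (Fin (N - 2))) (a : ℝ) (x : E N) :
    act N hN α θ (a • x) = a • act N hN α θ x := by
  ext i
  have h : (WithLp.toLp 2 fun j : Fin (N - 2) => (a • x) ⟨(j : ℕ) + 2, by have := j.isLt; omega⟩ :
      EuclideanSpace ℝ (Fin (N - 2))) =
    a • (WithLp.toLp 2 fun j : Fin (N - 2) => x ⟨(j : ℕ) + 2, by have := j.isLt; omega⟩) := by
    ext j; simp
  simp only [act, PiLp.smul_apply, smul_eq_mul]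
  split_ifs
  · ring
  · ring
  · have h2 := congrArg θ h
    rw [map_smul] at h2
    exact congrArg (fun z : EuclideanSpace ℝ (Fin (N - 2)) => z ⟨(i : ℕ) - 2, by have := i.isLt; omega⟩) h2

theorem act_norm (N : ℕ) (hN : 2 ≤ N) (α : ℝ)
    (θ : EuclideanSpace ℝ (Fin (N - 2)) ≃ₗᵢ[ℝ] EuclideanSpace ℝ (Fin (N - 2))) (x : E N) :
    ‖act N hN α θ x‖ = ‖x‖ := by
  obtain ⟨m, rfl⟩ : ∃ m, N = m + 2 := ⟨N - 2, by omega⟩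
  rw [← sq_eq_sq₀ (norm_nonneg _) (norm_nonneg _), EuclideanSpace.norm_sq_eq,
    EuclideanSpace.norm_sq_eq, Fin.sum_univ_succ, Fin.sum_univ_succ, Fin.sum_univ_succ,
    Fin.sum_univ_succ]
  set y : EuclideanSpace ℝ (Fin (m + 2 - 2)) :=
    WithLp.toLp 2 fun j : Fin (m + 2 - 2) => x ⟨(j : ℕ) + 2, by have := j.isLt; omega⟩ with hy
  have h1 : ∑ i : Fin m, ‖act (m + 2) hN α θ x i.succ.succ‖ ^ 2 = ‖θ y‖ ^ 2 := by
    rw [EuclideanSpace.norm_sq_eq]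
    refine Finset.sum_congr rfl fun i _ => ?_
    have : act (m + 2) hN α θ x i.succ.succ = θ y i := by
      simp [act, hy]
    rw [this]
  have h2 : ∑ i : Fin m, ‖x i.succ.succ‖ ^ 2 = ‖y‖ ^ 2 := by
    rw [EuclideanSpace.norm_sq_eq]
    rfl
  rw [h1, h2, LinearIsometryEquiv.norm_map]
  have h3 : act (m + 2) hN α θ x 0 = cos α * x 0 - sin α * x (Fin.succ 0) := by
    simp [act]
  have h4 : act (m + 2) hN α θ x (Fin.succ 0) = sin α * x 0 + cos α * x (Fin.succ 0) := by
    simp [act]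
  rw [h3, h4, Real.norm_eq_abs, Real.norm_eq_abs, Real.norm_eq_abs, Real.norm_eq_abs, sq_abs,
    sq_abs, sq_abs, sq_abs]
  have := sin_sq_add_cos_sq α
  linear_combination (x 0 ^ 2 + x (Fin.succ 0) ^ 2) * this

/-- `act` as a linear isometric equivalence. -/
noncomputable def actE (N : ℕ) (hN : 2 ≤ N) (α : ℝ)
    (θ : EuclideanSpace ℝ (Fin (N - 2)) ≃ₗᵢ[ℝ] EuclideanSpace ℝ (Fin (N - 2))) :
    E N ≃ₗᵢ[ℝ] E N :=
  LinearIsometry.toLinearIsometryEquiv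
    { toFun := act N hN α θ
      map_add' := act_add N hN α θ
      map_smul' := act_smul N hN α θ
      norm_map' := act_norm N hN α θ } rfl

theorem actE_apply (N : ℕ) (hN : 2 ≤ N) (α : ℝ)
    (θ : EuclideanSpace ℝ (Fin (N - 2)) ≃ₗᵢ[ℝ] EuclideanSpace ℝ (Fin (N - 2))) (x : E N) :
    actE N hN α θ x = act N hN α θ x := rfl

/-- The point `R e^{ia}` in the plane. -/
noncomputable def cpt (N : ℕ) (hN : 2 ≤ N) (R a : ℝ) : E N :=
  R • embedC N hN (Complex.exp ((a : ℂ) * Complex.I))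

theorem act_cpt (N : ℕ) (hN : 2 ≤ N) (α : ℝ)
    (θ : EuclideanSpace ℝ (Fin (N - 2)) ≃ₗᵢ[ℝ] EuclideanSpace ℝ (Fin (N - 2))) (R a : ℝ) :
    act N hN α θ (cpt N hN R a) = cpt N hN R (a + α) := by
  unfold cpt
  rw [act_smul]
  congr 1
  ext i
  simp only [act, embedC, Complex.exp_ofReal_mul_I_re, Complex.exp_ofReal_mul_I_im, cos_add, sin_add]
  by_cases h0 : (i : ℕ) = 0
  · simp [h0]; ring
  by_cases h1 : (i : ℕ) = 1
  · simp [h1]; ring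
  · have h2 : (WithLp.toLp 2 fun j : Fin (N - 2) => if (j : ℕ) + 2 = 0 then cos a
        else if (j : ℕ) + 2 = 1 then sin a else 0) = (0 : EuclideanSpace ℝ (Fin (N - 2))) := by
      ext j; simp
    simp only [h0, h1, dif_neg, if_neg, not_false_eq_true, dite_false, ite_false]
    rw [h2, map_zero]; rfl

theorem embedC_norm (N : ℕ) (hN : 2 ≤ N) (w : ℂ) : ‖embedC N hN w‖ = ‖w‖ := by
  obtain ⟨m, rfl⟩ : ∃ m, N = m + 2 := ⟨N - 2, by omega⟩
  rw [← sq_eq_sq₀ (norm_nonneg _) (norm_nonneg _), EuclideanSpace.norm_sq_eq,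
    Fin.sum_univ_succ, Fin.sum_univ_succ, ← Complex.normSq_eq_norm_sq, Complex.normSq_apply]
  simp [embedC]
  ring

theorem embedC_sub (N : ℕ) (hN : 2 ≤ N) (w z : ℂ) :
    embedC N hN (w - z) = embedC N hN w - embedC N hN z := by
  ext i
  simp only [embedC, PiLp.sub_apply]
  split_ifs <;> simp

theorem cpt_norm (N : ℕ) (hN : 2 ≤ N) {R : ℝ} (hR : 0 ≤ R) (a : ℝ) : ‖cpt N hN R a‖ = R := by
  rw [cpt, norm_smul, embedC_norm, Complex.norm_exp_ofReal_mul_I, Real.norm_of_nonneg hR, mul_one]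

theorem cpt_dist (N : ℕ) (hN : 2 ≤ N) {R : ℝ} (hR : 0 ≤ R) (a b : ℝ) :
    ‖cpt N hN R a - cpt N hN R b‖ = R * (2 * |sin ((a - b) / 2)|) := by
  have h : Complex.exp ((a : ℂ) * Complex.I) - Complex.exp ((b : ℂ) * Complex.I) =
      Complex.exp ((b : ℂ) * Complex.I) * (Complex.exp (Complex.I * ((a - b : ℝ) : ℂ)) - 1) := by
    rw [mul_sub, ← Complex.exp_add, mul_one]
    congr 2
    push_cast; ring
  rw [cpt, cpt, ← smul_sub, ← embedC_sub, norm_smul, embedC_norm, Real.norm_of_nonneg hR, h,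
    norm_mul, Complex.norm_exp_ofReal_mul_I, Complex.norm_exp_I_mul_ofReal_sub_one, one_mul,
    Real.norm_eq_abs, abs_mul, abs_two]

theorem cpt_periodic (N : ℕ) (hN : 2 ≤ N) (R a : ℝ) :
    cpt N hN R (a + 2 * π) = cpt N hN R a := by
  unfold cpt
  congr 2
  rw [Complex.ofReal_add, add_mul, Complex.exp_add]
  push_cast
  rw [Complex.exp_two_pi_mul_I, mul_one]

theorem sin_sep (L : ℕ) (hL : 2 ≤ L) (m : ℤ) (hm : ¬ (L : ℤ) ∣ m) :
    sin (π / L) ≤ |sin (π * m / L)| := by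
  have hL0 : (0 : ℝ) < L := by positivity
  have hdm := Int.emod_add_mul_ediv m L
  set r := m % L with hr
  set q := m / L with hq
  have hr0 : 0 < r := by
    have := Int.emod_nonneg m (by omega : (L : ℤ) ≠ 0)
    rcases this.lt_or_eq with h | h
    · exact h
    · exact absurd (Int.dvd_of_emod_eq_zero h.symm) hm
  have hrL : r < L := Int.emod_lt_of_pos m (by omega)
  have h1 : π * m / L = π * r / L + q * π := by
    rw [← hdm]; push_cast; field_simp
  rw [h1, Real.sin_add_int_mul_pi]
  have hr1 : (1 : ℝ) ≤ r := by exact_mod_cast hr0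
  have hr2 : (r : ℝ) + 1 ≤ L := by exact_mod_cast hrL
  have hsin : sin (π / L) ≤ sin (π * r / L) := by
    have hpi := pi_pos
    have hx1 : π / L ≤ π * r / L := by
      gcongr; nlinarith
    have hx2 : π * r / L ≤ π - π / L := by
      rw [div_le_iff₀ hL0, sub_mul, div_mul_cancel₀ _ hL0.ne']; nlinarith
    have hx0 : 0 < π / L := by positivity
    by_cases hx : π * r / L ≤ π / 2
    · exact Real.sin_le_sin_of_le_of_le_pi_div_two (by linarith) hx hx1
    · rw [← Real.sin_pi_sub (π * r / L)]
      exact Real.sin_le_sin_of_le_of_le_pi_div_two (by linarith) (by linarith) (by linarith)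
  have : |(-1 : ℝ) ^ q * sin (π * r / L)| = |sin (π * r / L)| := by
    rw [abs_mul, abs_zpow, abs_neg, abs_one, one_zpow, one_mul]
  rw [this]
  exact hsin.trans (le_abs_self _)

theorem cpt_sep (N : ℕ) (hN : 2 ≤ N) (L : ℕ) (hL : 2 ≤ L) {R r : ℝ} (hR : 0 < R)
    (hr : r ≤ sin (π / L) * R) (a b : ℝ) (m : ℤ) (hm : ¬ (L : ℤ) ∣ m)
    (hab : a - b = 2 * π * m / L) (x : E N) (hxa : ‖x - cpt N hN R a‖ < r)
    (hxb : ‖x - cpt N hN R b‖ < r) : False := by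
  have h1 := cpt_dist N hN hR.le a b
  have h2 : (a - b) / 2 = π * m / L := by rw [hab]; ring
  rw [h2] at h1
  have h3 := sin_sep L hL m hm
  have h4 : ‖cpt N hN R a - cpt N hN R b‖ ≤ ‖x - cpt N hN R a‖ + ‖x - cpt N hN R b‖ := by
    have := norm_sub_le (x - cpt N hN R b) (x - cpt N hN R a)
    rw [sub_sub_sub_cancel_left] at this
    linarith
  nlinarith

theorem grad_comp_iso {N : ℕ} (e : E N ≃ₗᵢ[ℝ] E N) {u : E N → ℝ} (hu : Differentiable ℝ u) (x : E N) :
    ‖gradient (fun y => u (e y)) x‖ = ‖gradient u (e x)‖ := by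
  have h1 : HasGradientAt (fun y => u (e y)) (e.symm (gradient u (e x))) x := by
    have h2 := (hu (e x)).hasGradientAt.hasFDerivAt
    have h3 := h2.comp x e.toContinuousLinearEquiv.hasFDerivAt
    rw [hasGradientAt_iff_hasFDerivAt]
    refine h3.congr_fderiv ?_
    ext y
    simp
    rw [← e.inner_map_map]
    simp
  rw [h1.gradient, LinearIsometryEquiv.norm_map]

theorem grad_comp_iso_eq {N : ℕ} (e : E N ≃ₗᵢ[ℝ] E N) {u : E N → ℝ} (hu : Differentiable ℝ u) (x : E N) :
    gradient (fun y => u (e y)) x = e.symm (gradient u (e x)) := by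
  have h1 : HasGradientAt (fun y => u (e y)) (e.symm (gradient u (e x))) x := by
    have h2 := (hu (e x)).hasGradientAt.hasFDerivAt
    have h3 := h2.comp x e.toContinuousLinearEquiv.hasFDerivAt
    rw [hasGradientAt_iff_hasFDerivAt]
    refine h3.congr_fderiv ?_
    ext y
    simp
    rw [← e.inner_map_map]
    simp
  rw [h1.gradient]

theorem integral_comp_iso {N : ℕ} (e : E N ≃ₗᵢ[ℝ] E N) (f : E N → ℝ) :
    ∫ x, f (e x) = ∫ x, f x :=
  e.measurePreserving.integral_comp e.toHomeomorph.measurableEmbedding f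

theorem normVSq_comp_iso {N : ℕ} (e : E N ≃ₗᵢ[ℝ] E N) {V : E N → ℝ} (hV : Radial N V)
    {u : E N → ℝ} (hu : Differentiable ℝ u) :
    normVSq N V (fun y => u (e y)) = normVSq N V u := by
  unfold normVSq
  rw [← integral_comp_iso e (fun x => ‖gradient u x‖ ^ 2 + V x * u x ^ 2)]
  congr 1
  ext x
  rw [grad_comp_iso e hu, hV x (e x) (by simp)]

theorem memH1_comp_iso {N : ℕ} (e : E N ≃ₗᵢ[ℝ] E N) {u : E N → ℝ} (hu : MemH1 N u) :
    MemH1 N (fun y => u (e y)) := by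
  obtain ⟨h1, h2, h3⟩ := hu
  refine ⟨h1.comp e.toContinuousLinearEquiv.differentiable, h2.comp_measurePreserving e.measurePreserving, ?_⟩
  have h4 := h3.comp_measurePreserving e.measurePreserving
  refine MemLp.of_le h4 ?_ (ae_of_all _ fun x => ?_)
  · have : (fun x => gradient (fun y => u (e y)) x) = fun x => e.symm (gradient u (e x)) := by
      ext1 x; exact grad_comp_iso_eq e h1 x
    rw [this]
    exact e.symm.continuous.comp_aestronglyMeasurable h4.1
  · rw [grad_comp_iso e h1]; rfl



theorem sum_single_apply {X : Type*} [AddCommMonoid X] (n : ℕ) (f : ℕ → X) (G : X → ℝ)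
    (hG : G 0 = 0)
    (h : ∀ j ∈ Finset.range n, ∀ k ∈ Finset.range n, j ≠ k → f j = 0 ∨ f k = 0) :
    G (∑ j ∈ Finset.range n, f j) = ∑ j ∈ Finset.range n, G (f j) := by
  by_cases hall : ∀ j ∈ Finset.range n, f j = 0
  · rw [Finset.sum_eq_zero hall, hG, Finset.sum_eq_zero]
    intro j hj; rw [hall j hj, hG]
  · push Not at hall
    obtain ⟨j, hj, hfj⟩ := hall
    have hk : ∀ k ∈ Finset.range n, k ≠ j → f k = 0 := fun k hk hkj =>
      (h k hk j hj hkj).resolve_right hfj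
    rw [Finset.sum_eq_single_of_mem j hj hk, Finset.sum_eq_single_of_mem j hj]
    intro k hk' hkj; rw [hk k hk' hkj, hG]

theorem grad_sub {N : ℕ} {u : E N → ℝ} (hu : Differentiable ℝ u) (c x : E N) :
    HasGradientAt (fun y => u (y - c)) (gradient u (x - c)) x := by
  have h2 := (hu (x - c)).hasGradientAt.hasFDerivAt
  rw [hasGradientAt_iff_hasFDerivAt]
  have h3 : HasFDerivAt (fun y : E N => y - c) (ContinuousLinearMap.id ℝ (E N)) x :=
    (hasFDerivAt_id x).sub_const c
  exact h2.comp x h3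

theorem grad_sum {N : ℕ} {u : E N → ℝ} (hu : Differentiable ℝ u) (n : ℕ) (c : ℕ → E N) (x : E N) :
    HasGradientAt (fun y => ∑ j ∈ Finset.range n, u (y - c j))
      (∑ j ∈ Finset.range n, gradient u (x - c j)) x := by
  rw [hasGradientAt_iff_hasFDerivAt, map_sum]
  exact HasFDerivAt.fun_sum fun j _ => (grad_sub hu (c j) x).hasFDerivAt

theorem bumps_H1 {N : ℕ} {u : E N → ℝ} (hu : MemH1 N u) (n : ℕ) (c : ℕ → E N) :
    MemH1 N (fun y => ∑ j ∈ Finset.range n, u (y - c j)) := by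
  obtain ⟨h1, h2, h3⟩ := hu
  refine ⟨fun x => (grad_sum h1 n c x).differentiableAt, ?_, ?_⟩
  · exact memLp_finsetSum _ fun j _ =>
      h2.comp_measurePreserving (measurePreserving_sub_right volume (c j))
  · have : (fun x => gradient (fun y => ∑ j ∈ Finset.range n, u (y - c j)) x) =
        fun x => ∑ j ∈ Finset.range n, gradient u (x - c j) := by
      ext1 x; exact (grad_sum h1 n c x).gradient
    rw [this]
    exact memLp_finsetSum _ fun j _ =>
      h3.comp_measurePreserving (measurePreserving_sub_right volume (c j))

theorem bumps_normVSq {N : ℕ} {u V : E N → ℝ} (hu : Differentiable ℝ u) (n : ℕ) (c : ℕ → E N)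
    (r : ℝ) (hout : ∀ y, r ≤ ‖y‖ → u y = 0 ∧ gradient u y = 0)
    (hdis : ∀ j ∈ Finset.range n, ∀ k ∈ Finset.range n, j ≠ k → ∀ x,
      ‖x - c j‖ < r → ‖x - c k‖ < r → False)
    (hint : ∀ j ∈ Finset.range n, Integrable (fun y => ‖gradient u y‖ ^ 2 + V (y + c j) * u y ^ 2)) :
    normVSq N V (fun y => ∑ j ∈ Finset.range n, u (y - c j)) =
      ∑ j ∈ Finset.range n, ∫ y, (‖gradient u y‖ ^ 2 + V (y + c j) * u y ^ 2) := by
  have hpt : ∀ x, ‖gradient (fun y => ∑ j ∈ Finset.range n, u (y - c j)) x‖ ^ 2 +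
      V x * (∑ j ∈ Finset.range n, u (x - c j)) ^ 2 =
      ∑ j ∈ Finset.range n, (‖gradient u (x - c j)‖ ^ 2 + V (x - c j + c j) * u (x - c j) ^ 2) := by
    intro x
    rw [(grad_sum hu n c x).gradient]
    have := sum_single_apply n (fun j => (gradient u (x - c j), u (x - c j)))
      (fun z : E N × ℝ => ‖z.1‖ ^ 2 + V x * z.2 ^ 2) (by simp) (by
        intro j hj k hk hjk
        by_cases h : r ≤ ‖x - c j‖
        · left; rw [(hout _ h).1, (hout _ h).2]; rfl
        · right
          have h' : r ≤ ‖x - c k‖ := by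
            by_contra h'
            exact hdis j hj k hk hjk x (not_le.1 h) (not_le.1 h')
          rw [(hout _ h').1, (hout _ h').2]; rfl)
    simp only [Prod.fst_sum, Prod.snd_sum] at this
    rw [this]
    simp
  unfold normVSq
  simp_rw [hpt]
  rw [integral_finsetSum]
  · refine Finset.sum_congr rfl fun j _ => ?_
    exact integral_sub_right_eq_self (fun y => ‖gradient u y‖ ^ 2 + V (y + c j) * u y ^ 2) (c j)
  · intro j hj
    exact (hint j hj).comp_sub_right (c j)

theorem bumps_pow {N : ℕ} {u : E N → ℝ} (n : ℕ) (c : ℕ → E N) (q : ℝ) (hq : 0 < q)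
    (r : ℝ) (hout : ∀ y, r ≤ ‖y‖ → u y = 0)
    (hdis : ∀ j ∈ Finset.range n, ∀ k ∈ Finset.range n, j ≠ k → ∀ x,
      ‖x - c j‖ < r → ‖x - c k‖ < r → False)
    (hint : Integrable (fun y => |u y| ^ q)) :
    ∫ x, |∑ j ∈ Finset.range n, u (x - c j)| ^ q = n * ∫ y, |u y| ^ q := by
  have hpt : ∀ x, |∑ j ∈ Finset.range n, u (x - c j)| ^ q =
      ∑ j ∈ Finset.range n, |u (x - c j)| ^ q := by
    intro x
    exact sum_single_apply n (fun j => u (x - c j))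
      (fun z : ℝ => |z| ^ q) (by simp [Real.zero_rpow hq.ne']) (by
        intro j hj k hk hjk
        by_cases h : r ≤ ‖x - c j‖
        · left; exact hout _ h
        · right
          apply hout
          by_contra h'
          exact hdis j hj k hk hjk x (not_le.1 h) (not_le.1 h'))
  simp_rw [hpt]
  rw [integral_finsetSum]
  · rw [Finset.sum_congr rfl fun j _ =>
      integral_sub_right_eq_self (fun y => |u y| ^ q) (c j)]
    simp
  · intro j hj
    exact hint.comp_sub_right (c j)

theorem grad_const_mul {N : ℕ} {u : E N → ℝ} (hu : Differentiable ℝ u) (t : ℝ) (x : E N) :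
    HasGradientAt (fun y => t * u y) (t • gradient u x) x := by
  rw [hasGradientAt_iff_hasFDerivAt]
  have h2 := (hu x).hasGradientAt.hasFDerivAt.const_mul t
  refine h2.congr_fderiv ?_
  simp

theorem scale_H1 {N : ℕ} {u : E N → ℝ} (hu : MemH1 N u) (t : ℝ) :
    MemH1 N (fun y => t * u y) := by
  obtain ⟨h1, h2, h3⟩ := hu
  refine ⟨h1.const_mul t, h2.const_mul t, ?_⟩
  have : (fun x => gradient (fun y => t * u y) x) = fun x => t • gradient u x := by
    ext1 x; exact (grad_const_mul h1 t x).gradient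
  rw [this]
  exact h3.const_smul t

theorem scale_normVSq {N : ℕ} {u V : E N → ℝ} (hu : Differentiable ℝ u) (t : ℝ) :
    normVSq N V (fun y => t * u y) = t ^ 2 * normVSq N V u := by
  unfold normVSq
  rw [← integral_const_mul]
  congr 1
  ext x
  rw [(grad_const_mul hu t x).gradient, norm_smul, mul_pow, Real.norm_eq_abs, sq_abs]
  ring

theorem scale_pow {N : ℕ} {u : E N → ℝ} {t : ℝ} (ht : 0 < t) (q : ℝ) :
    ∫ x, |t * u x| ^ q = t ^ q * ∫ x, |u x| ^ q := by
  rw [← integral_const_mul]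
  congr 1
  ext x
  rw [abs_mul, abs_of_pos ht, Real.mul_rpow ht.le (abs_nonneg _)]



theorem nehari_est (p A m c₁ : ℝ) (hp : 1 < p) (hA : 0 < A) (hm : 0 < m) (hc : 0 < c₁) :
    ∃ C' > 0, ∃ δ > 0, ∀ e a b t : ℝ, 0 < e → e ≤ 1 → 0 < t → m ≤ a → a ≤ A - (c₁ - δ) * e →
      A - δ * e ≤ b → b ≤ A → 0 < b ∧
      (t ^ 2 * a = t ^ (2 * p) * b → (p - 1) / p * (t ^ 2 * a) ≤ (p - 1) / p * A - C' * e) := by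
  refine ⟨(m / A) ^ (1 / (p - 1)) * c₁ / 2, by positivity, min (c₁ / 8) (A / 2), by positivity, ?_⟩
  intro e a b t he he1 ht hma haA hAb hbA
  set δ := min (c₁ / 8) (A / 2) with hδ
  have hδ1 : δ ≤ c₁ / 8 := min_le_left _ _
  have hδ2 : δ ≤ A / 2 := min_le_right _ _
  have hδ0 : 0 < δ := by positivity
  have hb2 : A / 2 ≤ b := by
    have : δ * e ≤ δ * 1 := by gcongr
    linarith
  have hb : 0 < b := by linarith
  refine ⟨hb, fun hneh => ?_⟩
  have ha : 0 < a := by linarith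
  have haA' : a ≤ A := by
    have : 0 ≤ (c₁ - δ) * e := mul_nonneg (by linarith) he.le
    linarith
  set s := t ^ 2 with hs
  have hs0 : 0 < s := by positivity
  have hsp : t ^ (2 * p) = s ^ p := by
    rw [hs, ← Real.rpow_natCast t 2, ← Real.rpow_mul ht.le]; norm_num
  rw [hsp] at hneh
  have hspp : s ^ p = s * s ^ (p - 1) := by
    rw [Real.rpow_sub_one hs0.ne']; field_simp
  have hq : s ^ (p - 1) = a / b := by
    rw [hspp] at hneh
    rw [eq_div_iff hb.ne']
    have : s * (s ^ (p - 1) * b) = s * a := by linarith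
    exact mul_left_cancel₀ hs0.ne' this
  have hq2 : s ^ (p - 1) ≤ 2 := by
    rw [hq, div_le_iff₀ hb]; linarith
  have hq1 : m / A ≤ s ^ (p - 1) := by
    rw [hq]; gcongr
  have hsσ : (m / A) ^ (1 / (p - 1)) ≤ s := by
    have h1 : (m / A) ^ (1 / (p - 1)) ≤ (s ^ (p - 1)) ^ (1 / (p - 1)) :=
      Real.rpow_le_rpow (by positivity) hq1 (by
        have : 0 < p - 1 := by linarith
        positivity)
    rwa [← Real.rpow_mul hs0.le, mul_one_div_cancel (by linarith : p - 1 ≠ 0), Real.rpow_one] at h1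
  have hbern : 1 + p * (s - 1) ≤ s ^ p := by
    have := one_add_mul_self_le_rpow_one_add (s := s - 1) (by linarith) hp.le
    simpa using this
  have hsp2 : s ^ p ≤ 2 * s := by rw [hspp]; nlinarith
  have hsp0 : 0 < s ^ p := by positivity
  have hp0 : 0 < p := by linarith
  -- clear denominators
  have key : (p - 1) * (s * a) ≤ (p - 1) * A - p * ((m / A) ^ (1 / (p - 1)) * c₁ / 2 * e) := by
    have e1 : (p - 1) * (s * a) = p * (s * a) - s ^ p * b := by rw [← hneh]; ring
    have e2 : s * a ≤ s * (A - (c₁ - δ) * e) := by gcongr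
    have e3 : s ^ p * (A - δ * e) ≤ s ^ p * b := by gcongr
    have e4 : A * (1 + p * (s - 1)) ≤ A * s ^ p := by gcongr
    have e5 : δ * e * s ^ p ≤ δ * e * (2 * s) := by gcongr
    have e6 : (m / A) ^ (1 / (p - 1)) * (c₁ / 2 * e) ≤ s * (c₁ / 2 * e) := by gcongr
    have e7 : p * (s * a) ≤ p * (s * (A - (c₁ - δ) * e)) := by gcongr
    have e8 : p * ((m / A) ^ (1 / (p - 1)) * (c₁ / 2 * e)) ≤ p * (s * (c₁ / 2 * e)) := by gcongr
    have e9 : 0 ≤ (s * e) * (p * (c₁ / 2 - δ) - 2 * δ) := by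
      apply mul_nonneg (by positivity)
      nlinarith
    nlinarith
  have : (p - 1) / p * (s * a) = ((p - 1) * (s * a)) / p := by ring
  rw [this, div_le_iff₀ hp0]
  have : ((p - 1) / p * A - (m / A) ^ (1 / (p - 1)) * c₁ / 2 * e) * p =
    (p - 1) * A - p * ((m / A) ^ (1 / (p - 1)) * c₁ / 2 * e) := by field_simp
  linarith

theorem nehari_exists (p a b : ℝ) (hp : 1 < p) (ha : 0 < a) (hb : 0 < b) :
    ∃ t > 0, t ^ 2 * a = t ^ (2 * p) * b := by
  have hp2 : 2 * p - 2 ≠ 0 := by linarith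
  refine ⟨(a / b) ^ (1 / (2 * p - 2)), by positivity, ?_⟩
  set t := (a / b) ^ (1 / (2 * p - 2)) with ht
  have ht0 : 0 < t := by positivity
  have h1 : t ^ (2 * p - 2) = a / b := by
    rw [ht, ← Real.rpow_mul (by positivity), one_div_mul_cancel hp2, Real.rpow_one]
  have h2 : t ^ (2 * p) = t ^ 2 * t ^ (2 * p - 2) := by
    rw [← Real.rpow_natCast t 2, ← Real.rpow_add ht0]; norm_num
  rw [h2, h1]; field_simp

theorem bumpSum_eq (N : ℕ) (hN : 2 ≤ N) (n : ℕ) (ω χ : E N → ℝ) (ϱ R : ℝ) :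
    bumpSum N hN n ω χ ϱ R = fun x =>
      ∑ j ∈ Finset.range n, trunc N ω χ (ϱ * R) (x - cpt N hN R (2 * π * (j : ℝ) / (n : ℝ))) := rfl

theorem act_sub_cpt (N : ℕ) (hN : 2 ≤ N) (α : ℝ)
    (θ : EuclideanSpace ℝ (Fin (N - 2)) ≃ₗᵢ[ℝ] EuclideanSpace ℝ (Fin (N - 2))) (R a : ℝ) (x : E N) :
    ‖act N hN α θ x - cpt N hN R a‖ = ‖x - cpt N hN R (a - α)‖ := by
  have h1 : cpt N hN R a = act N hN α θ (cpt N hN R (a - α)) := by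
    rw [act_cpt]; simp
  rw [h1, ← actE_apply, ← actE_apply, ← map_sub, LinearIsometryEquiv.norm_map]

theorem trunc_radial {N : ℕ} {ω χ : E N → ℝ} (hω : Radial N ω) (hχ : Radial N χ) (r : ℝ) :
    Radial N (trunc N ω χ r) := by
  intro x y h
  simp only [trunc]
  rw [hω x y h, hχ (r⁻¹ • x) (r⁻¹ • y) (by rw [norm_smul, norm_smul, h])]

theorem bumpSum_symm (N : ℕ) (hN : 2 ≤ N) (n : ℕ) (hn : 1 ≤ n) {ω χ : E N → ℝ}
    (hω : Radial N ω) (hχ : Radial N χ) (ϱ R : ℝ)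
    (θ : EuclideanSpace ℝ (Fin (N - 2)) ≃ₗᵢ[ℝ] EuclideanSpace ℝ (Fin (N - 2))) (x : E N) :
    bumpSum N hN n ω χ ϱ R (act N hN (2 * π / (n : ℝ)) θ x) = bumpSum N hN n ω χ ϱ R x := by
  rw [bumpSum_eq]
  simp only
  have hrad := trunc_radial hω hχ (ϱ * R)
  have h1 : ∀ j ∈ Finset.range n,
      trunc N ω χ (ϱ * R) (act N hN (2 * π / (n : ℝ)) θ x - cpt N hN R (2 * π * (j : ℝ) / (n : ℝ))) =
      trunc N ω χ (ϱ * R) (x - cpt N hN R (2 * π * (j : ℝ) / (n : ℝ) - 2 * π / n)) :=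
    fun j _ => hrad _ _ (act_sub_cpt N hN _ θ R _ x)
  rw [Finset.sum_congr rfl h1]
  obtain ⟨k, rfl⟩ : ∃ k, n = k + 1 := ⟨n - 1, by omega⟩
  rw [Finset.sum_range_succ', Finset.sum_range_succ]
  have hk : ((k : ℝ) + 1) ≠ 0 := by positivity
  congr 1
  · refine Finset.sum_congr rfl fun j _ => ?_
    congr 3
    push_cast; field_simp; ring
  · congr 2
    rw [← cpt_periodic]
    congr 1
    push_cast; field_simp; ring

theorem bumpSum_ne (N : ℕ) (hN : 2 ≤ N) (n : ℕ) {ω χ : E N → ℝ} {ϱ R : ℝ} (hR : 0 < ϱ * R)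
    (hω : Differentiable ℝ ω) (hχ : Differentiable ℝ χ) (hχ01 : ∀ x, 0 ≤ χ x ∧ χ x ≤ 1)
    (hχ0 : ∀ x : E N, 1 ≤ ‖x‖ → χ x = 0) (α : ℝ)
    (θ : EuclideanSpace ℝ (Fin (N - 2)) ≃ₗᵢ[ℝ] EuclideanSpace ℝ (Fin (N - 2))) (x : E N)
    (h : bumpSum N hN n ω χ ϱ R (act N hN α θ x) ≠ 0) :
    ∃ j < n, ‖x - cpt N hN R (2 * π * (j : ℝ) / (n : ℝ) - α)‖ < ϱ * R := by
  by_contra hcon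
  push Not at hcon
  apply h
  rw [bumpSum_eq]
  apply Finset.sum_eq_zero
  intro j hj
  refine (trunc_out hR hω hχ hχ01 hχ0 _ ?_).1
  rw [act_sub_cpt]
  exact hcon j (Finset.mem_range.1 hj)

theorem centers_sep (N : ℕ) (hN : 2 ≤ N) (ℓ n : ℕ) (hℓ : 2 ≤ ℓ) (hn : 1 ≤ n) {R r : ℝ}
    (hR : 0 < R) (hr : r ≤ sin (π / ((ℓ : ℝ) * (n : ℝ))) * R) (j k : ℕ) (hj : j < n) (hk : k < n)
    (hjk : j ≠ k) (x : E N) (h1 : ‖x - cpt N hN R (2 * π * (j : ℝ) / (n : ℝ))‖ < r)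
    (h2 : ‖x - cpt N hN R (2 * π * (k : ℝ) / (n : ℝ))‖ < r) : False := by
  have hℓ0 : (ℓ : ℝ) ≠ 0 := by positivity
  have hn0 : (n : ℝ) ≠ 0 := by positivity
  refine cpt_sep N hN (ℓ * n) (by nlinarith) hR (by push_cast; exact hr) _ _
    ((ℓ : ℤ) * ((j : ℤ) - k)) ?_ ?_ x h1 h2
  · intro hd
    push_cast at hd
    have hd2 := Int.dvd_of_mul_dvd_mul_left (by omega : (ℓ : ℤ) ≠ 0) hd
    have := Int.eq_zero_of_abs_lt_dvd hd2 (by rw [abs_lt]; omega)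
    omega
  · push_cast; field_simp

theorem comps_sep (N : ℕ) (hN : 2 ≤ N) (ℓ n : ℕ) (hℓ : 2 ≤ ℓ) (hn : 1 ≤ n) {R r : ℝ}
    (hR : 0 < R) (hr : r ≤ sin (π / ((ℓ : ℝ) * (n : ℝ))) * R) (i i' : Fin ℓ) (hii : i ≠ i')
    (j k : ℕ) (x : E N)
    (h1 : ‖x - cpt N hN R (2 * π * (j : ℝ) / (n : ℝ) -
      2 * π * ((i : ℕ) : ℝ) / ((ℓ : ℝ) * (n : ℝ)))‖ < r)
    (h2 : ‖x - cpt N hN R (2 * π * (k : ℝ) / (n : ℝ) -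
      2 * π * ((i' : ℕ) : ℝ) / ((ℓ : ℝ) * (n : ℝ)))‖ < r) : False := by
  have hℓ0 : (ℓ : ℝ) ≠ 0 := by positivity
  have hn0 : (n : ℝ) ≠ 0 := by positivity
  refine cpt_sep N hN (ℓ * n) (by nlinarith) hR (by push_cast; exact hr) _ _
    ((ℓ : ℤ) * ((j : ℤ) - k) - ((i : ℕ) - (i' : ℕ) : ℤ)) ?_ ?_ x h1 h2
  · intro hd
    push_cast at hd
    have hd1 : (ℓ : ℤ) ∣ (ℓ : ℤ) * ((j : ℤ) - k) - ((i : ℕ) - (i' : ℕ) : ℤ) :=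
      (Dvd.intro _ rfl).trans hd
    have hd2 : (ℓ : ℤ) ∣ ((i : ℕ) - (i' : ℕ) : ℤ) :=
      (dvd_sub_right (Dvd.intro _ rfl)).1 hd1
    have hi := i.isLt
    have hi' := i'.isLt
    have := Int.eq_zero_of_abs_lt_dvd hd2 (by rw [abs_lt]; omega)
    exact hii (Fin.ext (by omega))
  · push_cast; field_simp; ring

set_option maxHeartbeats 400000 in
/-- **Lemma 4.2** (Energy estimate for the test tuple `w_R`), together with its
consequence `ĉ^{φ_n} < ℓ n 𝔠_∞`. -/
theorem statement16 (N ℓ n : ℕ) (hN : 4 ≤ N) (hℓ : 2 ≤ ℓ) (hn : 1 ≤ n)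
    (p β : ℝ) (hp : 1 < p) (hp' : p < (N : ℝ) / ((N : ℝ) - 2)) (hβ : β < 0)
    (V : E N → ℝ) (Vinf : ℝ) (hVcont : Continuous V)
    (hV1 : Radial N V) (hV2 : HypV2 N V Vinf)
    (lam C₀ R₀ : ℝ) (hC₀ : 0 < C₀) (hR₀ : 0 < R₀)
    (hlam0 : 0 < lam) (hlam1 : lam < 2 * Real.sin (π / ((ℓ : ℝ) * (n : ℝ))))
    (hV3 : ∀ x : E N, R₀ ≤ ‖x‖ →
      V x ≤ Vinf - C₀ * Real.exp (-lam * Real.sqrt Vinf * ‖x‖))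
    (ε : ℝ) (hε0 : 0 < ε)
    (hε1 : ε < (2 * Real.sin (π / ((ℓ : ℝ) * (n : ℝ))) - lam) /
      (2 * Real.sin (π / ((ℓ : ℝ) * (n : ℝ))) + lam))
    (ϱ : ℝ) (hϱ : ϱ = (2 * Real.sin (π / ((ℓ : ℝ) * (n : ℝ))) + lam) / 4)
    (ω : E N → ℝ) (hω : IsEqSolution N (fun _ => Vinf) 1 p ω) (hωpos : ∀ x, 0 < ω x)
    (hωrad : Radial N ω)
    (hωNehari : normVSq N (fun _ => Vinf) ω = ∫ x, |ω x| ^ (2 * p))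
    (hωleast : Jfun N (fun _ => Vinf) p ω = cInfty N p Vinf)
    (χ : E N → ℝ) (hχsmooth : ContDiff ℝ (⊤ : ℕ∞) χ) (hχrad : Radial N χ)
    (hχ01 : ∀ x, 0 ≤ χ x ∧ χ x ≤ 1)
    (hχ1 : ∀ x : E N, ‖x‖ ≤ 1 - ε → χ x = 1)
    (hχ0 : ∀ x : E N, 1 ≤ ‖x‖ → χ x = 0) :
    (∃ C₁ > 0, ∃ R₁ > 0, ∀ R ≥ R₁,
      (∃ t > 0, normVSq N V (fun x => t * bumpSum N (by omega) n ω χ ϱ R x) =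
        ∫ x, |t * bumpSum N (by omega) n ω χ ϱ R x| ^ (2 * p)) ∧
      ∀ t > 0,
        normVSq N V (fun x => t * bumpSum N (by omega) n ω χ ϱ R x) =
          (∫ x, |t * bumpSum N (by omega) n ω χ ϱ R x| ^ (2 * p)) →
        ((p - 1) / (2 * p) *
            ∑ i, normVSq N V (testTuple N (by omega) ℓ n ω χ ϱ R t i) =
          energy N ℓ V β p (testTuple N (by omega) ℓ n ω χ ϱ R t) ∧
        energy N ℓ V β p (testTuple N (by omega) ℓ n ω χ ϱ R t) ≤
          (ℓ : ℝ) * (n : ℝ) * cInfty N p Vinf -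
            C₁ * Real.exp (-lam * Real.sqrt Vinf * R))) ∧
    hatC N (by omega) ℓ n (by omega) V p < (ℓ : ℝ) * (n : ℝ) * cInfty N p Vinf := by

  have hN2 : 2 ≤ N := by omega
  have hℓ0 : 0 < ℓ := by omega
  set d := 2 * Real.sin (π / ((ℓ : ℝ) * (n : ℝ))) with hd
  have hdl : 0 < d + lam := by linarith
  have hε1' : ε < 1 := hε1.trans_le (by rw [div_le_one hdl]; linarith)
  have hd2 : d ≤ 2 := by
    have := Real.sin_le_one (π / ((ℓ : ℝ) * (n : ℝ)))
    rw [hd]; linarith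
  have hϱ0 : 0 < ϱ := by rw [hϱ]; positivity
  have hϱ1 : ϱ < 1 := by rw [hϱ]; linarith
  have hkey : lam < 2 * (1 - ε) * ϱ := by
    rw [lt_div_iff₀ hdl] at hε1
    rw [hϱ]; nlinarith
  have hϱd : ϱ ≤ Real.sin (π / ((ℓ : ℝ) * (n : ℝ))) := by
    have : Real.sin (π / ((ℓ : ℝ) * (n : ℝ))) = d / 2 := by rw [hd]; ring
    rw [this, hϱ]; linarith
  obtain ⟨c₁, hc₁, m, hm, hbump⟩ := one_bump N hN p hp V Vinf hVcont hV2 lam C₀ R₀ hC₀ hlam0 hV3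
    ε hε1' ϱ hϱ0 hϱ1 hkey ω hω hωpos hωrad hωNehari χ hχsmooth hχ01 hχ1 hχ0
  set A := ∫ x, |ω x| ^ (2 * p) with hA
  have hp0 : 0 < p := by linarith
  have hVi : 0 < Vinf := hV2.2.1
  have hsV : 0 < √Vinf := Real.sqrt_pos.2 hVi
  have hχd : Differentiable ℝ χ := hχsmooth.differentiable (by simp)
  have hn0 : (0 : ℝ) < n := by positivity
  have hℓr : (0 : ℝ) < ℓ := by positivity
  have hcI : cInfty N p Vinf = (p - 1) / (2 * p) * A := by
    rw [← hωleast, Jfun, hωNehari, ← hA]; field_simp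
  -- positivity of `A`
  have hA0 : 0 < A := by
    obtain ⟨R₁, hR₁, h⟩ := hbump c₁ hc₁
    have h1 := h R₁ le_rfl
    have h2 := h1.1 (cpt N hN2 R₁ 0) (cpt_norm N hN2 hR₁.le 0)
    have := h2.2.1.trans h2.2.2
    rw [sub_self, zero_mul, sub_zero] at this
    linarith
  obtain ⟨C', hC', δ, hδ, hest⟩ := nehari_est p A m c₁ hp hA0 hm hc₁
  obtain ⟨R₁, hR₁, hb⟩ := hbump δ hδ
  -- facts for every large radius
  have main : ∀ R ≥ R₁, ∃ a b : ℝ, 0 < a ∧ 0 < b ∧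
      MemH1 N (bumpSum N hN2 n ω χ ϱ R) ∧
      (∀ t > 0, normVSq N V (fun x => t * bumpSum N hN2 n ω χ ϱ R x) = t ^ 2 * a) ∧
      (∀ t > 0, ∫ x, |t * bumpSum N hN2 n ω χ ϱ R x| ^ (2 * p) = t ^ (2 * p) * b) ∧
      (∀ t > 0, t ^ 2 * a = t ^ (2 * p) * b →
        (p - 1) / p * (t ^ 2 * a) ≤ n * ((p - 1) / p * A - C' * exp (-lam * √Vinf * R))) := by
    intro R hR
    have hR0 : 0 < R := lt_of_lt_of_le hR₁ hR
    obtain ⟨hbv, hbi, hb1, hb2⟩ := hb R hR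
    set u := trunc N ω χ (ϱ * R) with hu
    set e := exp (-lam * √Vinf * R) with he
    have he0 : 0 < e := exp_pos _
    have he1 : e ≤ 1 := by
      rw [he, Real.exp_le_one_iff]
      have : 0 < lam * √Vinf * R := by positivity
      linarith
    have hr0 : 0 < ϱ * R := by positivity
    have huH : MemH1 N u := trunc_H1 hω.1 hχsmooth hχ01 hχ0
    have hout := trunc_out hr0 hω.1.1 hχd hχ01 hχ0
    have hdis : ∀ j ∈ Finset.range n, ∀ k ∈ Finset.range n, j ≠ k → ∀ x : E N,
        ‖x - cpt N hN2 R (2 * π * (j : ℝ) / (n : ℝ))‖ < ϱ * R →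
        ‖x - cpt N hN2 R (2 * π * (k : ℝ) / (n : ℝ))‖ < ϱ * R → False := by
      intro j hj k hk hjk x h1 h2
      exact centers_sep N hN2 ℓ n hℓ hn hR0 (by gcongr) j k (Finset.mem_range.1 hj)
        (Finset.mem_range.1 hk) hjk x h1 h2
    have hcn : ∀ a : ℝ, ‖cpt N hN2 R a‖ = R := fun a => cpt_norm N hN2 hR0.le a
    have hSH : MemH1 N (bumpSum N hN2 n ω χ ϱ R) := by
      rw [bumpSum_eq]; exact bumps_H1 huH n _
    have hSn := bumps_normVSq (V := V) huH.1 n (fun j : ℕ => cpt N hN2 R (2 * π * (j : ℝ) / (n : ℝ)))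
      (ϱ * R) hout hdis (fun j _ => (hbv _ (hcn _)).1)
    have hSp := bumps_pow (u := u) n (fun j : ℕ => cpt N hN2 R (2 * π * (j : ℝ) / (n : ℝ)))
      (2 * p) (by positivity) (ϱ * R) (fun y hy => (hout y hy).1) hdis hbi
    have hSn' : normVSq N V (bumpSum N hN2 n ω χ ϱ R) = _ := hSn
    have hSp' : ∫ x, |bumpSum N hN2 n ω χ ϱ R x| ^ (2 * p) = _ := hSp
    set b := ∫ y, |u y| ^ (2 * p) with hbdef
    set a := normVSq N V (bumpSum N hN2 n ω χ ϱ R) / n with hadef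
    have han : normVSq N V (bumpSum N hN2 n ω χ ϱ R) = n * a := by rw [hadef]; field_simp
    have hma : m ≤ a := by
      rw [hadef, le_div_iff₀ hn0, hSn']
      have := Finset.sum_le_sum (s := Finset.range n) fun j _ =>
        (hbv (cpt N hN2 R (2 * π * (j : ℝ) / (n : ℝ))) (hcn _)).2.1
      rw [Finset.sum_const, Finset.card_range, nsmul_eq_mul] at this
      linarith
    have haA : a ≤ A - (c₁ - δ) * e := by
      rw [hadef, div_le_iff₀ hn0, hSn']
      have := Finset.sum_le_sum (s := Finset.range n) fun j _ =>
        (hbv (cpt N hN2 R (2 * π * (j : ℝ) / (n : ℝ))) (hcn _)).2.2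
      rw [Finset.sum_const, Finset.card_range, nsmul_eq_mul] at this
      linarith
    have hest' := fun t ht => hest e a b t he0 he1 ht hma haA hb1 hb2
    refine ⟨n * a, n * b, mul_pos hn0 (by linarith), mul_pos hn0 (hest' 1 one_pos).1, hSH, ?_, ?_, ?_⟩
    · intro t _
      rw [scale_normVSq hSH.1, han]
    · intro t ht
      rw [scale_pow ht, hSp']
    · intro t ht hneh
      have h1 : t ^ 2 * a = t ^ (2 * p) * b := by
        apply mul_left_cancel₀ hn0.ne'; linarith
      have h2 := (hest' t ht).2 h1
      calc (p - 1) / p * (t ^ 2 * (n * a)) = n * ((p - 1) / p * (t ^ 2 * a)) := by ring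
        _ ≤ _ := mul_le_mul_of_nonneg_left h2 hn0.le
  -- the components
  have hnorm : ∀ R ≥ R₁, ∀ t > 0, ∀ i, normVSq N V (testTuple N hN2 ℓ n ω χ ϱ R t i) =
      normVSq N V (fun x => t * bumpSum N hN2 n ω χ ϱ R x) := by
    intro R hR t ht i
    obtain ⟨a, b, -, -, hH, -⟩ := main R hR
    have h := normVSq_comp_iso (actE N hN2 (2 * π * ((i : ℕ) : ℝ) / ((ℓ : ℝ) * (n : ℝ))) (idO N)) hV1
      (scale_H1 hH t).1
    rw [← h]
    rfl
  have hpow : ∀ R t : ℝ, ∀ i, ∫ x, |testTuple N hN2 ℓ n ω χ ϱ R t i x| ^ (2 * p) =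
      ∫ x, |t * bumpSum N hN2 n ω χ ϱ R x| ^ (2 * p) := by
    intro R t i
    have h := integral_comp_iso (actE N hN2 (2 * π * ((i : ℕ) : ℝ) / ((ℓ : ℝ) * (n : ℝ))) (idO N))
      (fun x => |t * bumpSum N hN2 n ω χ ϱ R x| ^ (2 * p))
    rw [← h]
    rfl
  have hdisj : ∀ R ≥ R₁, ∀ t : ℝ, ∀ i k, i ≠ k → ∀ x,
      testTuple N hN2 ℓ n ω χ ϱ R t i x * testTuple N hN2 ℓ n ω χ ϱ R t k x = 0 := by
    intro R hR t i k hik x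
    have hR0 : 0 < R := lt_of_lt_of_le hR₁ hR
    have hr0 : 0 < ϱ * R := by positivity
    by_contra hne
    have h1 := right_ne_zero_of_mul (left_ne_zero_of_mul hne)
    have h2 := right_ne_zero_of_mul (right_ne_zero_of_mul hne)
    obtain ⟨j, -, hj⟩ := bumpSum_ne N hN2 n hr0 hω.1.1 hχd hχ01 hχ0 _ _ x h1
    obtain ⟨j', -, hj'⟩ := bumpSum_ne N hN2 n hr0 hω.1.1 hχd hχ01 hχ0 _ _ x h2
    exact comps_sep N hN2 ℓ n hℓ hn hR0 (by gcongr) i k hik j j' x hj hj'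
  have hcross : ∀ R ≥ R₁, ∀ t : ℝ, ∀ i k, i ≠ k →
      ∫ x, |testTuple N hN2 ℓ n ω χ ϱ R t i x| ^ p * |testTuple N hN2 ℓ n ω χ ϱ R t k x| ^ p = 0 := by
    intro R hR t i k hik
    have : ∀ x, |testTuple N hN2 ℓ n ω χ ϱ R t i x| ^ p *
        |testTuple N hN2 ℓ n ω χ ϱ R t k x| ^ p = 0 := by
      intro x
      rw [← Real.mul_rpow (abs_nonneg _) (abs_nonneg _), ← abs_mul, hdisj R hR t i k hik x,
        abs_zero, Real.zero_rpow hp0.ne']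
    simp only [this, integral_zero]
  have henergy : ∀ R ≥ R₁, ∀ t > 0,
      normVSq N V (fun x => t * bumpSum N hN2 n ω χ ϱ R x) =
          (∫ x, |t * bumpSum N hN2 n ω χ ϱ R x| ^ (2 * p)) →
      ((p - 1) / (2 * p) * ∑ i, normVSq N V (testTuple N hN2 ℓ n ω χ ϱ R t i) =
          energy N ℓ V β p (testTuple N hN2 ℓ n ω χ ϱ R t) ∧
        (p - 1) / (2 * p) * ∑ i, normVSq N V (testTuple N hN2 ℓ n ω χ ϱ R t i) ≤
          (ℓ : ℝ) * (n : ℝ) * cInfty N p Vinf -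
            (ℓ * n * C' / 2) * Real.exp (-lam * Real.sqrt Vinf * R)) := by
    intro R hR t ht hneh
    have hsum : ∑ i, normVSq N V (testTuple N hN2 ℓ n ω χ ϱ R t i) =
        ℓ * normVSq N V (fun x => t * bumpSum N hN2 n ω χ ϱ R x) := by
      rw [Finset.sum_congr rfl fun i _ => hnorm R hR t ht i]
      simp
    have hsum2 : ∑ i, ∫ x, |testTuple N hN2 ℓ n ω χ ϱ R t i x| ^ (2 * p) =
        ℓ * normVSq N V (fun x => t * bumpSum N hN2 n ω χ ϱ R x) := by
      rw [Finset.sum_congr rfl fun i _ => hpow R t i, hneh]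
      simp
    have hsum3 : ∑ i, ∑ j ∈ Finset.univ.erase i, ∫ x, |testTuple N hN2 ℓ n ω χ ϱ R t i x| ^ p *
        |testTuple N hN2 ℓ n ω χ ϱ R t j x| ^ p = 0 := by
      refine Finset.sum_eq_zero fun i _ => Finset.sum_eq_zero fun j hj => ?_
      exact hcross R hR t i j (Finset.ne_of_mem_erase hj).symm
    constructor
    · rw [energy, hsum3]
      simp only [mul_zero, sub_zero]
      rw [hsum, hsum2]
      field_simp
    · obtain ⟨a, b, ha, hb, hH, h1, h2, h3⟩ := main R hR
      rw [h1 t ht, h2 t ht] at hneh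
      have h4 := h3 t ht hneh
      rw [hsum, h1 t ht, hcI]
      have e1 : (p - 1) / (2 * p) * (ℓ * (t ^ 2 * a)) = ℓ / 2 * ((p - 1) / p * (t ^ 2 * a)) := by
        field_simp
      have e2 : (ℓ : ℝ) * n * ((p - 1) / (2 * p) * A) -
          ℓ * n * C' / 2 * exp (-lam * √Vinf * R) =
          ℓ / 2 * (n * ((p - 1) / p * A - C' * exp (-lam * √Vinf * R))) := by
        field_simp
      rw [e1, e2]
      exact mul_le_mul_of_nonneg_left h4 (by positivity)
  have hexists : ∀ R ≥ R₁, ∃ t > 0, normVSq N V (fun x => t * bumpSum N hN2 n ω χ ϱ R x) =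
        ∫ x, |t * bumpSum N hN2 n ω χ ϱ R x| ^ (2 * p) := by
    intro R hR
    obtain ⟨a, b, ha, hb, hH, h1, h2, h3⟩ := main R hR
    obtain ⟨t, ht, hh⟩ := nehari_exists p a b hp ha hb
    exact ⟨t, ht, by rw [h1 t ht, h2 t ht, hh]⟩
  refine ⟨⟨ℓ * n * C' / 2, by positivity, R₁, hR₁, fun R hR => ⟨hexists R hR, fun t ht hneh => ?_⟩⟩, ?_⟩
  · obtain ⟨h1, h2⟩ := henergy R hR t ht hneh
    exact ⟨h1, h1 ▸ h2⟩
  · obtain ⟨t, ht, hneh⟩ := hexists R₁ le_rfl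
    obtain ⟨-, h2⟩ := henergy R₁ le_rfl t ht hneh
    obtain ⟨a, b, ha, hb, hH, hn1, hn2, hn3⟩ := main R₁ le_rfl
    have hmem : testTuple N hN2 ℓ n ω χ ϱ R₁ t ∈ WeakPartition N hN2 ℓ n hℓ0 V p := by
      have h0 : ∀ x, testTuple N hN2 ℓ n ω χ ϱ R₁ t ⟨0, hℓ0⟩ x =
          t * bumpSum N hN2 n ω χ ϱ R₁ x := by
        intro x
        have : act N hN2 (2 * π * ((0 : ℕ) : ℝ) / ((ℓ : ℝ) * (n : ℝ))) (idO N) x = x := by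
          simp only [Nat.cast_zero, mul_zero, zero_div]
          ext i
          simp only [act, cos_zero, sin_zero, idO]
          split_ifs with h h'
          · simp only [one_mul, zero_mul, sub_zero]
            exact congrArg x.ofLp (Fin.ext (by simp [h]))
          · simp only [one_mul, zero_mul, zero_add]
            exact congrArg x.ofLp (Fin.ext (by simp [h']))
          · simp only [LinearIsometryEquiv.coe_refl, id]
            exact congrArg x.ofLp (Fin.ext (by simp; omega))
        simp only [testTuple]
        rw [this]
      refine ⟨fun i => ?_, ⟨fun θ x => ?_, fun j x => ?_⟩, fun i => ⟨?_, ?_⟩, hdisj R₁ le_rfl t⟩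
      · have h := memH1_comp_iso (actE N hN2 (2 * π * ((i : ℕ) : ℝ) / ((ℓ : ℝ) * (n : ℝ))) (idO N))
          (scale_H1 hH t)
        exact h
      · rw [h0, h0, bumpSum_symm N hN2 n hn hωrad hχrad]
      · rw [h0]; rfl
      · intro h
        have h3 := hnorm R₁ le_rfl t ht i
        rw [h, hn1 t ht] at h3
        have h4 : normVSq N V (0 : E N → ℝ) = 0 := by
          have : ∀ x, gradient (0 : E N → ℝ) x = 0 := fun x => by
            exact (hasGradientAt_const x (0 : ℝ)).gradient
          simp [normVSq, this]
        rw [h4] at h3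
        have : 0 < t ^ 2 * a := by positivity
        linarith
      · rw [hnorm R₁ le_rfl t ht i, hpow, hneh]
    have hle : hatC N hN2 ℓ n hℓ0 V p ≤
        (p - 1) / (2 * p) * ∑ i, normVSq N V (testTuple N hN2 ℓ n ω χ ϱ R₁ t i) := by
      refine csInf_le ⟨0, ?_⟩ ⟨_, hmem, rfl⟩
      rintro _ ⟨w, -, rfl⟩
      refine mul_nonneg (div_nonneg (by linarith) (by linarith)) (Finset.sum_nonneg fun i _ => ?_)
      refine integral_nonneg fun x => ?_
      obtain ⟨v, hv, hVv⟩ := hV2.1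
      have := hVv x
      exact add_nonneg (sq_nonneg _) (mul_nonneg (by linarith) (sq_nonneg _))
    have : 0 < ℓ * n * C' / 2 * exp (-lam * √Vinf * R₁) := by positivity
    linarith
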